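/- arXiv:2004.14926 — 2 statements merged into one kernel-verified Lean document; each statement's English description precedes it below -/
import Mathlib

section
/- For every δ > 0, dim_H(𝓔 ∩ (g, g+δ)) = 1 and dim_H(𝓔 ∩ (g+δ, 1)) < 1, where g = (√5 − 1)/2. -/
open Set Filter MeasureTheory
open scoped ENNReal

/-- The Tanaka–Ito `α`-continued fraction map. -/
noncomputable def T (α x : ℝ) : ℝ := if x = 0 then 0 else 1 / x - (⌊1 / x + 1 - α⌋ : ℝ)

/-- `J` is a matching interval with matching exponents `(M, N)`. -/
def IsMatchingInterval (J : Set ℝ) (M N : ℕ) : Prop :=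
  (∃ a b : ℝ, a < b ∧ J = Set.Ioo a b) ∧ J ⊆ Set.Icc 0 1 ∧
  (∀ α ∈ J, (T α)^[M] (α - 1) = (T α)^[N] α) ∧
  (∀ᵐ α ∂(volume.restrict J), (T α)^[M - 1] (α - 1) ≠ (T α)^[N - 1] α) ∧
  (∀ J' : Set ℝ, (∃ a b : ℝ, a < b ∧ J' = Set.Ioo a b) → J' ⊆ Set.Icc 0 1 →
    (∀ α ∈ J', (T α)^[M] (α - 1) = (T α)^[N] α) →
    (∀ᵐ α ∂(volume.restrict J'), (T α)^[M - 1] (α - 1) ≠ (T α)^[N - 1] α) →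
    J ⊆ J' → J' = J)

/-- The matching set: the union of all matching intervals. -/
def MatchingSet : Set ℝ := {x | ∃ (J : Set ℝ) (M N : ℕ), IsMatchingInterval J M N ∧ x ∈ J}

/-- The bifurcation set `𝓔`: the complement in `[0,1]` of the matching set. -/
def E : Set ℝ := Set.Icc 0 1 \ MatchingSet

/-- The small golden mean `g = (√5 - 1)/2`. -/
noncomputable def g : ℝ := (Real.sqrt 5 - 1) / 2

theorem g_sq : g ^ 2 = 1 - g := by
  have h : Real.sqrt 5 ^ 2 = 5 := Real.sq_sqrt (by norm_num)
  unfold g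
  nlinarith

theorem g_gt : 0.618 < g := by
  have : (2.236 : ℝ) < Real.sqrt 5 := Real.lt_sqrt_of_sq_lt (by norm_num)
  unfold g
  linarith

theorem g_lt : g < 0.6181 := by
  have : Real.sqrt 5 < 2.2362 := by
    rw [Real.sqrt_lt' (by norm_num)]
    norm_num
  unfold g
  linarith

theorem T_mem {α x : ℝ} (hx : x ≠ 0) : α - 1 ≤ T α x ∧ T α x < α := by
  unfold T
  rw [if_neg hx]
  have h1 := Int.floor_le (1 / x + 1 - α)
  have h2 := Int.lt_floor_add_one (1 / x + 1 - α)
  constructor <;> linarith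

theorem T_eq {α x y : ℝ} (n : ℤ) (hx : x ≠ 0) (h : 1 / x = n + y) (h1 : α - 1 ≤ y)
    (h2 : y < α) : T α x = y := by
  unfold T
  have : ⌊1 / x + 1 - α⌋ = n := by
    rw [Int.floor_eq_iff, h]
    constructor <;> linarith
  rw [if_neg hx, this, h]
  ring

theorem T_spec {α x : ℝ} (hx : x ≠ 0) : ∃ n : ℤ, 1 / x = n + T α x := by
  refine ⟨⌊1 / x + 1 - α⌋, ?_⟩
  unfold T
  rw [if_neg hx]
  ring

theorem irrational_T {α x : ℝ} (hx : Irrational x) : Irrational (T α x) := by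
  unfold T
  rw [if_neg hx.ne_zero, one_div]
  exact hx.inv.sub_intCast _

theorem irrational_iterate_T {α x : ℝ} (hx : Irrational x) (k : ℕ) :
    Irrational ((T α)^[k] x) := by
  induction k with
  | zero => exact hx
  | succ k ih =>
    rw [Function.iterate_succ_apply']
    exact irrational_T ih

theorem abs_iterate_T_lt_one {α x : ℝ} (h0 : 0 < α) (h1 : α < 1) (hx : Irrational x)
    (hx1 : |x| < 1) (k : ℕ) : |(T α)^[k] x| < 1 := by
  cases k with
  | zero => exact hx1
  | succ k =>
    rw [Function.iterate_succ_apply']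
    have := T_mem (α := α) (irrational_iterate_T (α := α) hx k).ne_zero
    rw [abs_lt]
    constructor <;> linarith

/-- The product of the absolute values along the first `k` points of an orbit of `T α`. -/
noncomputable def orbProd (α x : ℝ) (k : ℕ) : ℝ := ∏ i ∈ Finset.range k, |(T α)^[i] x|

theorem orbProd_zero (α x : ℝ) : orbProd α x 0 = 1 := by simp [orbProd]

theorem orbProd_succ (α x : ℝ) (k : ℕ) :
    orbProd α x (k + 1) = orbProd α x k * |(T α)^[k] x| := by
  simp [orbProd, Finset.prod_range_succ]

theorem orbProd_pos {α x : ℝ} (hx : Irrational x) (k : ℕ) : 0 < orbProd α x k :=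
  Finset.prod_pos fun i _ => abs_pos.2 (irrational_iterate_T hx i).ne_zero

theorem orbProd_strictAnti {α x : ℝ} (h0 : 0 < α) (h1 : α < 1) (hx : Irrational x)
    (hx1 : |x| < 1) : StrictAnti (orbProd α x) := by
  refine strictAnti_nat_of_succ_lt fun k => ?_
  rw [orbProd_succ]
  have h2 := orbProd_pos (α := α) hx k
  have h3 := abs_iterate_T_lt_one h0 h1 hx hx1 k
  nlinarith

theorem Transcendental.quadratic {α : ℝ} (h : Transcendental ℤ α) {a b c : ℤ}
    (habc : (a : ℝ) * α ^ 2 + b * α + c = 0) : a = 0 ∧ b = 0 ∧ c = 0 := by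
  rw [transcendental_iff] at h
  have h0 := h (Polynomial.C a * Polynomial.X ^ 2 + Polynomial.C b * Polynomial.X
    + Polynomial.C c) (by simpa using habc)
  refine ⟨?_, ?_, ?_⟩
  · simpa [Polynomial.coeff_X, Polynomial.coeff_C, -eq_intCast]
      using congrArg (fun p => p.coeff 2) h0
  · simpa [Polynomial.coeff_X, Polynomial.coeff_C, -eq_intCast]
      using congrArg (fun p => p.coeff 1) h0
  · simpa [Polynomial.coeff_X, Polynomial.coeff_C, -eq_intCast]
      using congrArg (fun p => p.coeff 0) h0

theorem Transcendental.irrational_real {α : ℝ} (h : Transcendental ℤ α) : Irrational α := by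
  rintro ⟨q, hq⟩
  have := h.quadratic (a := 0) (b := q.den) (c := -q.num) (by
    rw [← hq]
    have : (q : ℝ) = q.num / q.den := Rat.cast_def q
    have h2 : (q.den : ℝ) ≠ 0 := by exact_mod_cast q.den_nz
    rw [this]
    push_cast
    field_simp
    ring)
  exact q.den_nz (by exact_mod_cast this.2.1)

/-- Near `α`, the function `f` is given by a unimodular integer Möbius transformation whose
denominator at `α` has absolute value `P`. -/
def IsUnimodularNear (α : ℝ) (f : ℝ → ℝ) (P : ℝ) : Prop :=
  ∃ p q r s : ℤ, (p * s - q * r) ^ 2 = 1 ∧ |(r : ℝ) * α + s| = P ∧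
    ∀ᶠ β in nhds α, f β = (p * β + q) / (r * β + s)

theorem IsUnimodularNear.continuousAt {α P : ℝ} {f : ℝ → ℝ} (h : IsUnimodularNear α f P)
    (hP : 0 < P) : ContinuousAt f α := by
  obtain ⟨p, q, r, s, -, hP', hf⟩ := h
  have h0 : (r : ℝ) * α + s ≠ 0 := by
    rw [← abs_pos, hP']
    exact hP
  have hc : ContinuousAt (fun β : ℝ => ((p : ℝ) * β + q) / (r * β + s)) α :=
    ContinuousAt.div (by fun_prop) (by fun_prop) h0
  exact hc.congr (hf.mono fun _ h => h.symm)

theorem IsUnimodularNear.eq_of_apply_eq {α P P' : ℝ} {f f' : ℝ → ℝ} (hα : Transcendental ℤ α)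
    (h : IsUnimodularNear α f P) (h' : IsUnimodularNear α f' P') (hP : 0 < P) (hP' : 0 < P')
    (he : f α = f' α) : P = P' ∧ ∀ᶠ β in nhds α, f β = f' β := by
  obtain ⟨p, q, r, s, hd, rfl, hf⟩ := h
  obtain ⟨p', q', r', s', hd', rfl, hf'⟩ := h'
  have h0 := abs_pos.1 hP
  have h0' := abs_pos.1 hP'
  rw [hf.self_of_nhds, hf'.self_of_nhds, div_eq_div_iff h0 h0'] at he
  obtain ⟨e1, e2, e3⟩ := hα.quadratic (a := p * r' - p' * r)
    (b := p * s' + q * r' - p' * s - q' * r) (c := q * s' - q' * s) (by push_cast; linarith)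
  set e := s' * p - q' * r with he'
  have key : e ^ 2 = 1 := by
    have : e ^ 2 = (p' * s' - q' * r') * (p * s - q * r) := by
      have : e = p' * s - r' * q := by linarith
      calc e ^ 2 = e * e := sq e
        _ = (s' * p - q' * r) * (p' * s - r' * q) := by rw [← this]
        _ = _ := by linear_combination (q' * s - s' * q) * e1
    have h4 : (e ^ 2) ^ 2 = 1 := by rw [this, mul_pow, hd, hd']; norm_num
    nlinarith [sq_nonneg e]
  set d := p' * s' - q' * r' with hdd
  have hr : d * r = e * r' := by
    rw [he', hdd]; linear_combination (-s') * e1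
  have hs : d * s = e * s' := by
    rw [he', hdd]; linear_combination (-s') * e2 + r' * e3
  constructor
  · have h1 : (d : ℝ) * (r * α + s) = e * (r' * α + s') := by
      have hr' : (d : ℝ) * r = e * r' := by exact_mod_cast hr
      have hs' : (d : ℝ) * s = e * s' := by exact_mod_cast hs
      linear_combination α * hr' + hs'
    have hd1 : |(d : ℝ)| = 1 := by
      rw [← sq_eq_sq₀ (abs_nonneg _) zero_le_one, sq_abs]; exact_mod_cast (by simpa using hd')
    have he1 : |(e : ℝ)| = 1 := by
      rw [← sq_eq_sq₀ (abs_nonneg _) zero_le_one, sq_abs]; exact_mod_cast (by simpa using key)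
    simpa [abs_mul, hd1, he1] using congrArg abs h1
  · have c1 : ContinuousAt (fun β : ℝ => (r : ℝ) * β + s) α := by fun_prop
    have c2 : ContinuousAt (fun β : ℝ => (r' : ℝ) * β + s') α := by fun_prop
    filter_upwards [hf, hf', c1.eventually_ne h0, c2.eventually_ne h0'] with β h1 h2 h3 h4
    rw [h1, h2, div_eq_div_iff h3 h4]
    have i1 : (p : ℝ) * r' - p' * r = 0 := by exact_mod_cast e1
    have i2 : (p : ℝ) * s' + q * r' - p' * s - q' * r = 0 := by exact_mod_cast e2
    have i3 : (q : ℝ) * s' - q' * s = 0 := by exact_mod_cast e3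
    linear_combination β ^ 2 * i1 + β * i2 + i3

theorem isUnimodularNear_sub_intCast (α : ℝ) (c : ℤ) :
    IsUnimodularNear α (fun β => β - c) 1 :=
  ⟨1, -c, 0, 1, by norm_num, by norm_num, by filter_upwards with β; push_cast; ring⟩

theorem IsUnimodularNear.apply_ne_sub_intCast {α P : ℝ} {f : ℝ → ℝ} (hα : Transcendental ℤ α)
    (h : IsUnimodularNear α f P) (hP : 0 < P) (hP1 : P ≠ 1) (c : ℤ) : f α ≠ α - c := fun he =>
  hP1 (h.eq_of_apply_eq hα (isUnimodularNear_sub_intCast α c) hP one_pos he).1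

theorem IsUnimodularNear.T {α P : ℝ} {f : ℝ → ℝ} (hα : Transcendental ℤ α)
    (h : IsUnimodularNear α f P) (hP : 0 < P) (hP1 : P * |f α| < 1) (h0 : f α ≠ 0) :
    IsUnimodularNear α (fun β => T β (f β)) (P * |f α|) := by
  have hc := h.continuousAt hP
  obtain ⟨p, q, r, s, hd, rfl, hf⟩ := h
  have hne := abs_pos.1 hP
  have hfα := hf.self_of_nhds
  set n := ⌊1 / f α + 1 - α⌋ with hn
  have hprod : |(r : ℝ) * α + s| * |f α| = |(p : ℝ) * α + q| := by
    rw [hfα, ← abs_mul, mul_div_cancel₀ _ hne]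
  have hpq : (p : ℝ) * α + q ≠ 0 := by
    rw [← abs_pos, ← hprod]; exact mul_pos hP (abs_pos.2 h0)
  have hmob : ∀ β : ℝ, (p : ℝ) * β + q ≠ 0 → f β = (p * β + q) / (r * β + s) →
      1 / f β - n = ((r - n * p : ℤ) * β + (s - n * q : ℤ)) / (p * β + q) := by
    intro β h1 h2
    rw [h2, one_div_div, eq_div_iff h1, sub_mul, div_mul_cancel₀ _ h1]
    push_cast
    ring
  have hnot : (n : ℝ) ≠ 1 / f α + 1 - α := by
    intro hcon
    have hu : IsUnimodularNear α (fun β => 1 / f β - n) (|(r : ℝ) * α + s| * |f α|) := by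
      have c1 : ContinuousAt (fun β : ℝ => (p : ℝ) * β + q) α := by fun_prop
      refine ⟨r - n * p, s - n * q, p, q, ?_, hprod.symm, ?_⟩
      · rw [← hd]; ring
      · filter_upwards [hf, c1.eventually_ne hpq] with β h1 h2 using hmob β h2 h1
    refine hu.apply_ne_sub_intCast hα (mul_pos hP (abs_pos.2 h0)) hP1.ne 1 ?_
    push_cast
    linarith
  have c1 : ContinuousAt (fun β : ℝ => (p : ℝ) * β + q) α := by fun_prop
  have c2 : ContinuousAt (fun β : ℝ => 1 / f β + 1 - β) α :=
    ((continuousAt_const.div hc h0).add continuousAt_const).sub continuousAt_id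
  have l1 : (n : ℝ) < 1 / f α + 1 - α := lt_of_le_of_ne (Int.floor_le _) hnot
  have l2 : 1 / f α + 1 - α < n + 1 := Int.lt_floor_add_one _
  refine ⟨r - n * p, s - n * q, p, q, ?_, hprod.symm, ?_⟩
  · rw [← hd]; ring
  · filter_upwards [hf, c1.eventually_ne hpq, hc.eventually_ne h0, c2.eventually_lt_const l2,
      c2.eventually_const_lt l1] with β h1 h2 h3 h4 h5
    rw [← hmob β h2 h1]
    have : ⌊1 / f β + 1 - β⌋ = n := Int.floor_eq_iff.2 ⟨h5.le, h4⟩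
    simp only [_root_.T, if_neg h3, this]

theorem isUnimodularNear_iterate_T {α : ℝ} (hα : Transcendental ℤ α) (h0 : 0 < α) (h1 : α < 1)
    (c : ℤ) (hc : |α - c| < 1) (k : ℕ) :
    IsUnimodularNear α (fun β => (T β)^[k] (β - c)) (orbProd α (α - c) k) := by
  have hirr : Irrational (α - c) := hα.irrational_real.sub_intCast c
  induction k with
  | zero => simpa [orbProd_zero] using isUnimodularNear_sub_intCast α c
  | succ k ih =>
    simp only [Function.iterate_succ_apply', orbProd_succ]
    refine ih.T hα (orbProd_pos hirr k) ?_ (irrational_iterate_T hirr k).ne_zero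
    rw [← orbProd_succ]
    calc orbProd α (α - c) (k + 1) < orbProd α (α - c) 0 :=
          orbProd_strictAnti h0 h1 hirr hc (Nat.succ_pos k)
      _ = 1 := orbProd_zero _ _

theorem isUnimodularNear_left {α : ℝ} (hα : Transcendental ℤ α) (h0 : 0 < α) (h1 : α < 1)
    (k : ℕ) : IsUnimodularNear α (fun β => (T β)^[k] (β - 1)) (orbProd α (α - 1) k) := by
  simpa using isUnimodularNear_iterate_T hα h0 h1 1
    (by rw [abs_lt]; push_cast; constructor <;> linarith) k

theorem isUnimodularNear_right {α : ℝ} (hα : Transcendental ℤ α) (h0 : 0 < α) (h1 : α < 1)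
    (k : ℕ) : IsUnimodularNear α (fun β => (T β)^[k] β) (orbProd α α k) := by
  simpa using isUnimodularNear_iterate_T hα h0 h1 0
    (by rw [abs_lt]; push_cast; constructor <;> linarith) k

theorem orbProd_eq_of_matching {α : ℝ} (hα : Transcendental ℤ α) (h0 : 0 < α) (h1 : α < 1)
    {M N : ℕ} (h : (T α)^[M] (α - 1) = (T α)^[N] α) :
    orbProd α (α - 1) M = orbProd α α N :=
  ((isUnimodularNear_left hα h0 h1 M).eq_of_apply_eq hα (isUnimodularNear_right hα h0 h1 N)
    (orbProd_pos (by simpa using hα.irrational_real.sub_intCast 1) M)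
    (orbProd_pos hα.irrational_real N) h).1

theorem exists_first_matching {α : ℝ} (hα : Transcendental ℤ α) (h0 : 0 < α) (h1 : α < 1) :
    ∀ M N : ℕ, (T α)^[M] (α - 1) = (T α)^[N] α → ∃ M' N',
      (T α)^[M'] (α - 1) = (T α)^[N'] α ∧ (T α)^[M' - 1] (α - 1) ≠ (T α)^[N' - 1] α := by
  have hirr : Irrational (α - 1) := by simpa using hα.irrational_real.sub_intCast 1
  have a1 := orbProd_strictAnti h0 h1 hirr (by rw [abs_lt]; constructor <;> linarith)
  have a2 := orbProd_strictAnti h0 h1 hα.irrational_real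
    (by rw [abs_lt]; constructor <;> linarith)
  intro M
  induction M with
  | zero =>
    intro N h
    have h2 := orbProd_eq_of_matching hα h0 h1 h
    rw [orbProd_zero, ← orbProd_zero α α, a2.injective.eq_iff] at h2
    subst h2
    simp at h
  | succ M ih =>
    intro N h
    cases N with
    | zero =>
      have h2 := orbProd_eq_of_matching hα h0 h1 h
      have h3 := a1 (Nat.succ_pos M)
      rw [orbProd_zero] at h2 h3
      exact absurd h2 h3.ne
    | succ N =>
      by_cases h3 : (T α)^[M] (α - 1) = (T α)^[N] α
      · exact ih N h3
      · exact ⟨M + 1, N + 1, h, h3⟩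

theorem mem_matchingSet_of_mem_Ioo {α a b : ℝ} {M N : ℕ} (hα : α ∈ Ioo a b)
    (hab : Ioo a b ⊆ Icc 0 1) (heq : ∀ β ∈ Ioo a b, (T β)^[M] (β - 1) = (T β)^[N] β)
    (hne : ∀ᵐ β ∂(volume.restrict (Ioo a b)), (T β)^[M - 1] (β - 1) ≠ (T β)^[N - 1] β) :
    α ∈ MatchingSet := by
  set S : Set (Set ℝ) := {J | (∃ a b : ℝ, a < b ∧ J = Ioo a b) ∧ J ⊆ Icc 0 1 ∧
    (∀ β ∈ J, (T β)^[M] (β - 1) = (T β)^[N] β) ∧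
    (∀ᵐ β ∂(volume.restrict J), (T β)^[M - 1] (β - 1) ≠ (T β)^[N - 1] β) ∧ α ∈ J} with hS
  have hmem : Ioo a b ∈ S := ⟨⟨a, b, hα.1.trans hα.2, rfl⟩, hab, heq, hne, hα⟩
  have hopen : ∀ J ∈ S, IsOpen J := by
    rintro J ⟨⟨a, b, -, rfl⟩, -⟩
    exact isOpen_Ioo
  have hUo : IsOpen (⋃₀ S) := isOpen_sUnion hopen
  have hUc : IsPreconnected (⋃₀ S) := by
    refine isPreconnected_sUnion α S (fun J hJ => hJ.2.2.2.2) ?_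
    rintro J ⟨⟨a, b, -, rfl⟩, -⟩
    exact isPreconnected_Ioo
  have hU01 : ⋃₀ S ⊆ Icc 0 1 := sUnion_subset fun J hJ => hJ.2.1
  have hbb : BddBelow (⋃₀ S) := bddBelow_Icc.mono hU01
  have hba : BddAbove (⋃₀ S) := bddAbove_Icc.mono hU01
  have hαU : α ∈ ⋃₀ S := ⟨_, hmem, hα⟩
  have hU : ⋃₀ S = Ioo (sInf (⋃₀ S)) (sSup (⋃₀ S)) := by
    refine Subset.antisymm ?_ (IsConnected.Ioo_csInf_csSup_subset ⟨⟨α, hαU⟩, hUc⟩ hbb hba)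
    intro x hx
    obtain ⟨l, u, ⟨hl, hu⟩, hlu⟩ := mem_nhds_iff_exists_Ioo_subset.1 (hUo.mem_nhds hx)
    obtain ⟨y, hy1, hy2⟩ := exists_between hl
    obtain ⟨z, hz1, hz2⟩ := exists_between hu
    exact ⟨(csInf_le hbb (hlu ⟨hy1, hy2.trans hu⟩)).trans_lt hy2,
      hz1.trans_le (le_csSup hba (hlu ⟨hl.trans hz1, hz2⟩))⟩
  have hae : ∀ᵐ β ∂(volume.restrict (⋃₀ S)), (T β)^[M - 1] (β - 1) ≠ (T β)^[N - 1] β := by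
    obtain ⟨C, hC, hCS, hCU⟩ := TopologicalSpace.isOpen_sUnion_countable S hopen
    rw [← hCU, sUnion_eq_biUnion, ae_restrict_biUnion_iff _ hC]
    exact fun J hJ => (hCS hJ).2.2.2.1
  refine ⟨⋃₀ S, M, N, ⟨⟨_, _, ?_, hU⟩, hU01, ?_, hae, ?_⟩, hαU⟩
  · have := hU ▸ hαU
    exact this.1.trans this.2
  · rintro β ⟨J, hJ, hβ⟩
    exact hJ.2.2.1 β hβ
  · intro J' h1 h2 h3 h4 h5
    exact (subset_sUnion_of_mem (show J' ∈ S from ⟨h1, h2, h3, h4, h5 hαU⟩)).antisymm h5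

theorem mem_matchingSet_of_iterate_eq {α : ℝ} (hα : Transcendental ℤ α) (h0 : 0 < α)
    (h1 : α < 1) {M N : ℕ} (h : (T α)^[M] (α - 1) = (T α)^[N] α) : α ∈ MatchingSet := by
  obtain ⟨M, N, h, hne⟩ := exists_first_matching hα h0 h1 M N h
  have hi : Irrational (α - 1) := by simpa using hα.irrational_real.sub_intCast 1
  have e1 := ((isUnimodularNear_left hα h0 h1 M).eq_of_apply_eq hα
    (isUnimodularNear_right hα h0 h1 N) (orbProd_pos hi M) (orbProd_pos hα.irrational_real N) h).2
  have e2 := (((isUnimodularNear_left hα h0 h1 (M - 1)).continuousAt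
    (orbProd_pos hi _)).ne_iff_eventually_ne ((isUnimodularNear_right hα h0 h1
      (N - 1)).continuousAt (orbProd_pos hα.irrational_real _))).1 hne
  obtain ⟨a, b, hab, hsub⟩ := mem_nhds_iff_exists_Ioo_subset.1
    ((e1.and e2).and (Ioo_mem_nhds h0 h1))
  exact mem_matchingSet_of_mem_Ioo hab (fun β hβ => Ioo_subset_Icc_self (hsub hβ).2)
    (fun β hβ => (hsub hβ).1.1)
    ((ae_restrict_iff' measurableSet_Ioo).2 (Eventually.of_forall fun β hβ => (hsub hβ).1.2))

/-- The Gauss map. -/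
noncomputable def gauss (x : ℝ) : ℝ := Int.fract (1 / x)

theorem gauss_eq {x y : ℝ} (n : ℤ) (h : 1 / x = n + y) (h0 : 0 ≤ y) (h1 : y < 1) :
    gauss x = y := by
  unfold gauss
  rw [Int.fract_eq_iff]
  exact ⟨h0, h1, n, by rw [h]; ring⟩

/-- The irrational numbers in the open unit interval. -/
def irrUnit : Set ℝ := {x | Irrational x ∧ 0 < x ∧ x < 1}

theorem gauss_mem {x : ℝ} (hx : x ∈ irrUnit) : gauss x ∈ irrUnit := by
  have hi : Irrational (gauss x) := by
    unfold gauss Int.fract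
    rw [one_div]
    exact hx.1.inv.sub_intCast _
  exact ⟨hi, lt_of_le_of_ne (Int.fract_nonneg _) hi.ne_zero.symm, Int.fract_lt_one _⟩

theorem iterate_gauss_mem {x : ℝ} (hx : x ∈ irrUnit) (k : ℕ) : gauss^[k] x ∈ irrUnit := by
  induction k with
  | zero => exact hx
  | succ k ih =>
    rw [Function.iterate_succ_apply']
    exact gauss_mem ih

theorem gauss_spec (x : ℝ) : ∃ n : ℤ, 1 / x = n + gauss x :=
  ⟨⌊1 / x⌋, (Int.floor_add_fract _).symm⟩

theorem gauss_of_half_lt {x : ℝ} (h0 : 1 / 2 < x) (h1 : x < 1) : gauss x = (1 - x) / x := by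
  have hx : 0 < x := by linarith
  refine gauss_eq 1 (by field_simp; push_cast; ring) (div_nonneg (by linarith) hx.le) ?_
  rw [div_lt_one hx]
  linarith

theorem gauss_of_lt_half {x : ℝ} (h0 : 1 / 3 < x) (h1 : x < 1 / 2) :
    gauss x = (1 - 2 * x) / x := by
  have hx : 0 < x := by linarith
  refine gauss_eq 2 (by field_simp; push_cast; ring) (div_nonneg (by linarith) hx.le) ?_
  rw [div_lt_one hx]
  linarith

/-- The numbers `u, v ∈ [α - 1, α)` are congruent to `z, -z` modulo `1`, in some order. -/
def SyncPair (α z u v : ℝ) : Prop :=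
  α - 1 ≤ u ∧ u < α ∧ α - 1 ≤ v ∧ v < α ∧
    ((∃ n m : ℤ, u = z + n ∧ v = -z + m) ∨ (∃ n m : ℤ, u = -z + n ∧ v = z + m))

theorem SyncPair.symm {α z u v : ℝ} (h : SyncPair α z u v) : SyncPair α z v u := by
  obtain ⟨h1, h2, h3, h4, ⟨n, m, h5, h6⟩ | ⟨n, m, h5, h6⟩⟩ := h
  · exact ⟨h3, h4, h1, h2, Or.inr ⟨m, n, h6, h5⟩⟩
  · exact ⟨h3, h4, h1, h2, Or.inl ⟨m, n, h6, h5⟩⟩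

/-- The region in which the two orbits merge. -/
def Hole (α z : ℝ) : Prop := (1 - α < z ∧ z < α / (1 + α)) ∨ (1 / (1 + α) < z ∧ z < α)

theorem SyncPair.of_congr {α z x y : ℝ} {n m : ℤ} (hx : x ≠ 0) (hy : y ≠ 0)
    (h1 : 1 / x = z + n) (h2 : 1 / y = -z + m) : SyncPair α z (T α x) (T α y) := by
  obtain ⟨i, hi⟩ := T_spec (α := α) hx
  obtain ⟨j, hj⟩ := T_spec (α := α) hy
  refine ⟨(T_mem hx).1, (T_mem hx).2, (T_mem hy).1, (T_mem hy).2, Or.inl ⟨n - i, m - j, ?_, ?_⟩⟩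
  · push_cast; linarith
  · push_cast; linarith

theorem SyncPair.ne {α z u v : ℝ} (h : SyncPair α z u v) (hz : Irrational z) : u ≠ v := by
  intro he
  obtain ⟨-, -, -, -, ⟨n, m, h5, h6⟩ | ⟨n, m, h5, h6⟩⟩ := h
  · apply hz
    refine ⟨(m - n) / 2, ?_⟩
    push_cast
    linarith
  · apply hz
    refine ⟨(n - m) / 2, ?_⟩
    push_cast
    linarith

theorem div_one_add_eq {α : ℝ} (h : 0 < α) : α / (1 + α) = 1 - 1 / (1 + α) := by
  field_simp
  ring

theorem not_hole_of_le {α z : ℝ} (hα : g < α) (h : z ≤ 1 - α ∨ α ≤ z) : ¬ Hole α z := by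
  have h1 := g_gt
  have h2 : 1 / (1 + α) ≤ 1 - 0 := by
    rw [div_le_iff₀ (by linarith)]; linarith
  have h3 : 1 - α < 1 / (1 + α) := by
    rw [lt_div_iff₀ (by linarith)]; nlinarith
  have h4 := div_one_add_eq (α := α) (by linarith)
  rintro (⟨h5, h6⟩ | ⟨h5, h6⟩) <;> rcases h with h | h <;> linarith

/-- One synchronous step when the two points are opposite. -/
theorem SyncPair.step_opposite_aux {α z u v : ℝ} (hα : g < α) (hα1 : α < 1)
    (hz : z ∈ irrUnit) (hv : v = -u) (hu : α - 1 ≤ u) (hu' : α - 1 ≤ -u) {n : ℤ}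
    (h : u = z + n) :
    ¬ Hole α z ∧ ∃ j, 1 ≤ j ∧ j ≤ 2 ∧ SyncPair α (gauss^[j] z) (T α u) (T α v) := by
  obtain ⟨hzi, hz0, hz1⟩ := hz
  have hg := g_gt
  have hu0 : u ≠ 0 := by
    rw [h]; exact (hzi.add_intCast n).ne_zero
  have hv0 : v ≠ 0 := by rw [hv]; exact neg_ne_zero.2 hu0
  have hn1 : n < 1 := by
    have : (n : ℝ) < 1 := by linarith
    exact_mod_cast this
  have hn2 : -2 < n := by
    have : (-2 : ℝ) < n := by linarith
    exact_mod_cast this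
  obtain rfl | rfl : n = 0 ∨ n = -1 := by omega
  · simp only [Int.cast_zero, add_zero] at h
    subst h
    refine ⟨not_hole_of_le hα (Or.inl (by linarith)), 1, le_rfl, by norm_num, ?_⟩
    obtain ⟨a, ha⟩ := gauss_spec u
    rw [Function.iterate_one]
    refine SyncPair.of_congr (n := a) (m := -a) hu0 hv0 (by linarith) ?_
    rw [hv, div_neg, ha]
    push_cast
    ring
  · push_cast at h
    refine ⟨not_hole_of_le hα (Or.inr (by linarith)), 2, by norm_num, le_rfl, ?_⟩
    obtain ⟨a, ha⟩ := gauss_spec (gauss z)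
    have e : gauss z = (1 - z) / z := gauss_of_half_lt (by linarith) hz1
    have h1z : 1 - z ≠ 0 := by linarith
    have key : 1 / (1 - z) = (a + 1 : ℤ) + gauss (gauss z) := by
      have : 1 / (1 - z) = 1 / gauss z + 1 := by rw [e]; field_simp; ring
      rw [this, ha]; push_cast; ring
    change SyncPair α (gauss (gauss z)) _ _
    refine (SyncPair.of_congr (n := a + 1) (m := -(a + 1)) hv0 hu0 ?_ ?_).symm
    · have : v = 1 - z := by rw [hv, h]; ring
      rw [this, key]; ring
    · have : u = -(1 - z) := by rw [h]; ring
      rw [this, div_neg, key]; push_cast; ring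

theorem SyncPair.step_opposite {α z u v : ℝ} (hα : g < α) (hα1 : α < 1)
    (hz : z ∈ irrUnit) (h : SyncPair α z u v) (huv : u + v = 0) :
    ¬ Hole α z ∧ ∃ j, 1 ≤ j ∧ j ≤ 2 ∧ SyncPair α (gauss^[j] z) (T α u) (T α v) := by
  obtain ⟨h1, h2, h3, h4, ⟨n, m, h5, h6⟩ | ⟨n, m, h5, h6⟩⟩ := h
  · exact SyncPair.step_opposite_aux hα hα1 hz (by linarith) h1 (by linarith) h5
  · obtain ⟨h7, j, h8, h9, h10⟩ := SyncPair.step_opposite_aux (v := u) hα hα1 hz (by linarith) h3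
      (by linarith) h6
    exact ⟨h7, j, h8, h9, h10.symm⟩

theorem T_T_eq_of_lt {α u : ℝ} (h0 : 0 < α) (hα1 : α < 1) (hu : 1 / (1 + α) < u) (hu1 : u < 1) :
    T α (T α u) = T α (1 - u) := by
  have hu0 : 0 < u := lt_trans (by positivity) hu
  have e : T α u = (1 - u) / u := by
    refine T_eq 1 hu0.ne' (by field_simp; push_cast; ring) ?_ ?_
    · have : 0 < (1 - u) / u := div_pos (by linarith) hu0
      linarith
    · rw [div_lt_iff₀ hu0]
      rw [div_lt_iff₀ (by linarith)] at hu
      linarith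
  have h1 : 1 - u ≠ 0 := by linarith
  obtain ⟨n, hn⟩ := T_spec (α := α) h1
  refine T_eq (n - 1) ?_ ?_ (T_mem h1).1 (T_mem h1).2
  · rw [e]; exact div_ne_zero h1 hu0.ne'
  · rw [e]
    have : 1 / ((1 - u) / u) = 1 / (1 - u) - 1 := by field_simp; ring
    rw [this, hn]; push_cast; ring

theorem T_of_mem_middle {α u : ℝ} (hα : g < α) (h1 : α / (1 + α) ≤ u)
    (h2 : u ≤ 1 / (1 + α)) : T α u = (1 - 2 * u) / u := by
  have hg := g_gt
  have hgs := g_sq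
  have hα0 : 0 < α := by linarith
  have hu0 : 0 < u := lt_of_lt_of_le (by positivity) h1
  rw [div_le_iff₀ (by linarith)] at h1
  rw [le_div_iff₀ (by linarith)] at h2
  refine T_eq 2 hu0.ne' (by field_simp; push_cast; ring) ?_ ?_
  · rw [le_div_iff₀ hu0]; nlinarith
  · rw [div_lt_iff₀ hu0]
    have h3 : 1 < α + α ^ 2 := by nlinarith
    have h4 : 0 < u * (α + α ^ 2 - 1) := mul_pos hu0 (by linarith)
    nlinarith

theorem half_ne {z : ℝ} (hz : Irrational z) : z ≠ 1 / 2 := by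
  have := hz.ne_rat (1 / 2)
  simpa using this

/-- One synchronous step when the two points add up to one. -/
theorem SyncPair.step_complementary {α z : ℝ} (hα : g < α) (hα1 : α < 1)
    (hz : z ∈ irrUnit) (h1 : 1 - α < z) (h2 : z < α) :
    (¬ Hole α z ∧ |z| ≠ |1 - z| ∧ |z| * |T α z| = |1 - z| * |T α (1 - z)| ∧
      ∃ j, 1 ≤ j ∧ j ≤ 3 ∧ SyncPair α (gauss^[j] z) (T α (T α z)) (T α (T α (1 - z)))) ∨
    (Hole α z ∧ (T α (T α z) = T α (1 - z) ∨ T α z = T α (T α (1 - z)))) := by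
  obtain ⟨hzi, hz0, hz1⟩ := hz
  have hg := g_gt
  have hα0 : 0 < α := by linarith
  have hd := div_one_add_eq hα0
  by_cases hu : 1 / (1 + α) < z
  · exact Or.inr ⟨Or.inr ⟨hu, h2⟩, Or.inl (T_T_eq_of_lt hα0 hα1 hu hz1)⟩
  by_cases hl : z < α / (1 + α)
  · refine Or.inr ⟨Or.inl ⟨h1, hl⟩, Or.inr ?_⟩
    rw [T_T_eq_of_lt (u := 1 - z) hα0 hα1 (by linarith) (by linarith)]
    congr 1
    ring
  push Not at hu hl
  have hne := half_ne hzi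
  left
  have e1 := T_of_mem_middle hα hl hu
  have e2 := T_of_mem_middle (u := 1 - z) hα (by linarith) (by linarith)
  have hz' : 1 - z ≠ 0 := by linarith
  have hz2 : 1 - 2 * z ≠ 0 := fun h => hne (by linarith)
  have hz2' : 2 * z - 1 ≠ 0 := fun h => hne (by linarith)
  have e2' : T α (1 - z) = (2 * z - 1) / (1 - z) := by rw [e2]; ring
  have f1 : T α z ≠ 0 := by rw [e1]; exact div_ne_zero hz2 hz0.ne'
  have f2 : T α (1 - z) ≠ 0 := by rw [e2']; exact div_ne_zero hz2' hz'
  have l1 : 1 / 3 < z := by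
    refine lt_of_lt_of_le ?_ hl
    rw [lt_div_iff₀ (by linarith)]
    linarith
  have l2 : z < 2 / 3 := by
    refine lt_of_le_of_lt hu ?_
    rw [div_lt_iff₀ (by linarith)]
    linarith
  refine ⟨?_, ?_, ?_, ?_⟩
  · rintro (⟨h5, h6⟩ | ⟨h5, h6⟩) <;> linarith
  · rw [abs_of_pos hz0, abs_of_pos (by linarith)]
    intro h; exact hne (by linarith)
  · rw [← abs_mul, ← abs_mul, e1, e2', mul_div_cancel₀ _ hz0.ne', mul_div_cancel₀ _ hz',
      abs_sub_comm]
  have k1 : 1 / T α z = z / (1 - 2 * z) := by rw [e1, one_div_div]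
  have k2 : 1 / T α (1 - z) = -(z / (1 - 2 * z)) - 1 := by
    rw [e2', one_div_div]
    rw [div_eq_iff hz2', sub_mul, neg_mul, ← mul_neg, neg_sub, div_mul_cancel₀ _ hz2]
    ring
  rcases lt_or_gt_of_ne hne with hlt | hgt
  · obtain ⟨a, ha⟩ := gauss_spec (gauss z)
    rw [gauss_of_lt_half l1 hlt, one_div_div] at ha
    refine ⟨2, by norm_num, by norm_num, ?_⟩
    refine SyncPair.of_congr (n := a) (m := -a - 1) f1 f2 ?_ ?_
    · rw [k1, ha, add_comm, ← gauss_of_lt_half l1 hlt]; rfl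
    · rw [k2, ha, ← gauss_of_lt_half l1 hlt]
      change _ = - gauss (gauss z) + _
      push_cast
      ring
  · have hgz := gauss_of_half_lt hgt hz1
    have hggz : gauss (gauss z) = (2 * z - 1) / (1 - z) := by
      rw [gauss_of_half_lt, hgz]
      · field_simp
        ring
      · rw [hgz, lt_div_iff₀ hz0]; linarith
      · rw [hgz, div_lt_one hz0]; linarith
    obtain ⟨a, ha⟩ := gauss_spec (gauss (gauss z))
    refine ⟨3, by norm_num, by norm_num, ?_⟩
    have k3 : 1 / T α (1 - z) = a + gauss (gauss (gauss z)) := by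
      rw [← ha, hggz, e2']
    refine (SyncPair.of_congr (n := a) (m := -a - 1) f2 f1 ?_ ?_).symm
    · rw [k3, add_comm]; rfl
    · change _ = - gauss (gauss (gauss z)) + _
      rw [k1]
      push_cast
      linarith

theorem SyncPair.step {α z u v : ℝ} (hα : g < α) (hα1 : α < 1) (hz : z ∈ irrUnit)
    (h : SyncPair α z u v) :
    (¬ Hole α z ∧ |u| = |v| ∧
      ∃ j, 1 ≤ j ∧ j ≤ 3 ∧ SyncPair α (gauss^[j] z) (T α u) (T α v)) ∨
    (¬ Hole α z ∧ |u| ≠ |v| ∧ |u| * |T α u| = |v| * |T α v| ∧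
      ∃ j, 1 ≤ j ∧ j ≤ 3 ∧ SyncPair α (gauss^[j] z) (T α (T α u)) (T α (T α v))) ∨
    (Hole α z ∧ (T α (T α u) = T α v ∨ T α u = T α (T α v))) := by
  have hg := g_gt
  have hs : ∃ c : ℤ, u + v = c := by
    obtain ⟨-, -, -, -, ⟨n, m, h5, h6⟩ | ⟨n, m, h5, h6⟩⟩ := h
    · exact ⟨n + m, by push_cast; linarith⟩
    · exact ⟨n + m, by push_cast; linarith⟩
  obtain ⟨c, hc⟩ := hs
  have hc1 : -1 < c := by
    have : (-1 : ℝ) < c := by linarith [h.1, h.2.2.1]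
    exact_mod_cast this
  have hc2 : c < 2 := by
    have : (c : ℝ) < 2 := by linarith [h.2.1, h.2.2.2.1]
    exact_mod_cast this
  obtain rfl | rfl : c = 0 ∨ c = 1 := by omega
  · left
    have huv : u + v = 0 := by simpa using hc
    obtain ⟨h1, j, h2, h3, h4⟩ := h.step_opposite hα hα1 hz huv
    refine ⟨h1, ?_, j, h2, by omega, h4⟩
    rw [eq_neg_of_add_eq_zero_left huv, abs_neg]
  · right
    push_cast at hc
    have hzero : ∀ {w : ℝ} {n : ℤ}, w = z + n → 1 - α < w → w < α → w = z := by
      intro w n hw h1 h2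
      have i1 : -1 < n := by
        have : (-1 : ℝ) < n := by linarith [hz.2.2]
        exact_mod_cast this
      have i2 : n < 1 := by
        have : (n : ℝ) < 1 := by linarith [hz.2.1]
        exact_mod_cast this
      obtain rfl : n = 0 := by omega
      simpa using hw
    obtain ⟨h1, h2, h3, h4, ⟨n, m, h5, h6⟩ | ⟨n, m, h5, h6⟩⟩ := h
    · have hu : u = z := hzero h5 (by linarith) h2
      have hv : v = 1 - z := by linarith
      subst hu
      subst hv
      exact SyncPair.step_complementary hα hα1 hz (by linarith) h2
    · have hv : v = z := hzero h6 (by linarith) h4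
      have hu : u = 1 - z := by linarith
      subst hv
      subst hu
      rcases SyncPair.step_complementary hα hα1 hz (by linarith) h4 with
        ⟨i1, i2, i3, j, i4, i5, i6⟩ | ⟨i1, i2 | i2⟩
      · exact Or.inl ⟨i1, i2.symm, i3.symm, j, i4, i5, i6.symm⟩
      · exact Or.inr ⟨i1, Or.inr i2.symm⟩
      · exact Or.inr ⟨i1, Or.inl i2.symm⟩

theorem one_sub_mem_irrUnit {α : ℝ} (hi : Irrational α) (h0 : 0 < α) (h1 : α < 1) :
    1 - α ∈ irrUnit :=
  ⟨by simpa using hi.intCast_sub 1, by linarith, by linarith⟩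

theorem T_self {α : ℝ} (hα : g < α) (hα1 : α < 1) : T α α = (1 - α) / α := by
  have hg := g_gt
  have hα0 : 0 < α := by linarith
  refine T_eq 1 hα0.ne' (by field_simp; push_cast; ring) ?_ ?_
  · have : 0 < (1 - α) / α := div_pos (by linarith) hα0
    linarith
  · rw [div_lt_iff₀ hα0]
    nlinarith [g_sq]

theorem SyncPair.initial {α : ℝ} (hα : g < α) (hα1 : α < 1) :
    SyncPair α (gauss (1 - α)) ((T α)^[1] (α - 1)) ((T α)^[2] α) := by
  have hg := g_gt
  have hα0 : 0 < α := by linarith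
  have h1 : 1 - α ≠ 0 := by linarith
  obtain ⟨a, ha⟩ := gauss_spec (1 - α)
  have e := T_self hα hα1
  refine (SyncPair.of_congr (n := a - 1) (m := -a) (x := T α α) (y := α - 1) ?_ ?_ ?_ ?_).symm
  · rw [e]; exact div_ne_zero h1 hα0.ne'
  · linarith
  · have : 1 / T α α = 1 / (1 - α) - 1 := by rw [e]; field_simp; ring
    rw [this, ha]; push_cast; ring
  · rw [← neg_sub, div_neg, ha]; push_cast; ring

theorem exists_matching {α : ℝ} (hi : Irrational α) (hα : g < α) (hα1 : α < 1) {k₀ : ℕ}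
    (hH : ∀ i < 3, Hole α (gauss^[k₀ + i] (1 - α))) :
    ∃ M N, (T α)^[M] (α - 1) = (T α)^[N] α := by
  have hg := g_gt
  have hmem := iterate_gauss_mem (one_sub_mem_irrUnit hi (by linarith) hα1)
  have main : ∀ d k M N : ℕ, k₀ + 2 = k + d →
      SyncPair α (gauss^[k] (1 - α)) ((T α)^[M] (α - 1)) ((T α)^[N] α) →
      ∃ M N, (T α)^[M] (α - 1) = (T α)^[N] α := by
    intro d
    induction d using Nat.strong_induction_on with
    | _ d ih =>
      intro k M N hk hS
      have hcont : ∀ j M' N', 1 ≤ j → j ≤ 3 → ¬ Hole α (gauss^[k] (1 - α)) →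
          SyncPair α (gauss^[j] (gauss^[k] (1 - α))) ((T α)^[M'] (α - 1)) ((T α)^[N'] α) →
          ∃ M N, (T α)^[M] (α - 1) = (T α)^[N] α := by
        intro j M' N' hj1 hj3 hnot hS'
        rw [← Function.iterate_add_apply] at hS'
        have hkk : k < k₀ := by
          by_contra hcon
          refine hnot ?_
          obtain ⟨i, rfl⟩ := Nat.exists_eq_add_of_le (not_lt.1 hcon)
          exact hH i (by omega)
        exact ih (d - j) (by omega) (j + k) M' N' (by omega) hS'
      rcases hS.step hα hα1 (hmem k) with ⟨h1, -, j, h2, h3, h4⟩ | ⟨h1, -, -, j, h2, h3, h4⟩ |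
        ⟨-, h1 | h1⟩
      · refine hcont j (M + 1) (N + 1) h2 h3 h1 ?_
        rwa [Function.iterate_succ_apply', Function.iterate_succ_apply']
      · refine hcont j (M + 2) (N + 2) h2 h3 h1 ?_
        simpa only [Function.iterate_succ_apply'] using h4
      · exact ⟨M + 2, N + 1, by simpa only [Function.iterate_succ_apply'] using h1⟩
      · exact ⟨M + 1, N + 2, by simpa only [Function.iterate_succ_apply'] using h1⟩
  exact main (k₀ + 1) 1 1 2 (by omega) (SyncPair.initial hα hα1)

theorem iterate_ne_of_forall_not_hole {α : ℝ} (ht : Transcendental ℤ α) (hα : g < α)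
    (hα1 : α < 1) (hH : ∀ k, 1 ≤ k → ¬ Hole α (gauss^[k] (1 - α))) (M N : ℕ) :
    (T α)^[M] (α - 1) ≠ (T α)^[N] α := by
  intro he
  have hg := g_gt
  have hα0 : 0 < α := by linarith
  have hi := ht.irrational_real
  have hi' : Irrational (α - 1) := by simpa using hi.sub_intCast 1
  have hmem := iterate_gauss_mem (one_sub_mem_irrUnit hi hα0 hα1)
  have a1 := orbProd_strictAnti hα0 hα1 hi' (by rw [abs_lt]; constructor <;> linarith)
  have a2 := orbProd_strictAnti hα0 hα1 hi (by rw [abs_lt]; constructor <;> linarith)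
  have hP := orbProd_eq_of_matching ht hα0 hα1 he
  have main : ∀ d k m n : ℕ, 1 ≤ k → M = m + d → orbProd α (α - 1) m = orbProd α α n →
      SyncPair α (gauss^[k] (1 - α)) ((T α)^[m] (α - 1)) ((T α)^[n] α) → False := by
    intro d
    induction d using Nat.strong_induction_on with
    | _ d ih =>
      intro k m n hk hM hmn hS
      rcases Nat.eq_zero_or_pos d with rfl | hd
      · obtain rfl : M = m := by omega
        have : N = n := a2.injective (hP.symm.trans hmn)
        subst this
        exact hS.ne (hmem k).1 he
      rcases hS.step hα hα1 (hmem k) with ⟨-, h1, j, h2, h3, h4⟩ | ⟨-, h0, h1, j, h2, h3, h4⟩ |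
        ⟨h1, -⟩
      · refine ih (d - 1) (by omega) (j + k) (m + 1) (n + 1) (by omega) (by omega) ?_ ?_
        · rw [orbProd_succ, orbProd_succ, hmn, h1]
        · rw [Function.iterate_add_apply]
          rwa [Function.iterate_succ_apply', Function.iterate_succ_apply']
      · have hmn2 : orbProd α (α - 1) (m + 2) = orbProd α α (n + 2) := by
          simp only [orbProd_succ, Function.iterate_succ_apply', mul_assoc, hmn]
          rw [h1]
        by_cases hd1 : d = 1
        · have hM1 : M = m + 1 := by omega
          rw [hM1] at hP
          have hlt1 : orbProd α (α - 1) (m + 1) < orbProd α (α - 1) m := a1 (by omega)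
          have hlt2 : orbProd α (α - 1) (m + 2) < orbProd α (α - 1) (m + 1) := a1 (by omega)
          rw [hP, hmn, a2.lt_iff_gt] at hlt1
          rw [hP, hmn2, a2.lt_iff_gt] at hlt2
          obtain rfl : N = n + 1 := by omega
          rw [orbProd_succ, orbProd_succ, hmn] at hP
          exact h0 (mul_left_cancel₀ (orbProd_pos hi n).ne' hP)
        · refine ih (d - 2) (by omega) (j + k) (m + 2) (n + 2) (by omega) (by omega) hmn2 ?_
          rw [Function.iterate_add_apply]
          simpa only [Function.iterate_succ_apply'] using h4
      · exact hH k hk h1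
  rcases Nat.eq_zero_or_pos M with rfl | hM
  · rw [orbProd_zero, ← orbProd_zero α α, a2.injective.eq_iff] at hP
    subst hP
    simp at he
  · refine main (M - 1) 1 1 2 le_rfl (by omega) ?_ (SyncPair.initial hα hα1)
    simp only [orbProd_succ, orbProd_zero, Function.iterate_one, Function.iterate_zero, id, one_mul]
    rw [T_self hα hα1, ← abs_mul, mul_div_cancel₀ _ hα0.ne', abs_sub_comm]

theorem not_mem_matchingSet {α : ℝ} (ht : Transcendental ℤ α) (hα : g < α)
    (hα1 : α < 1) (hH : ∀ k, 1 ≤ k → ¬ Hole α (gauss^[k] (1 - α))) : α ∉ MatchingSet := by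
  rintro ⟨J, M, N, hJ, hαJ⟩
  exact iterate_ne_of_forall_not_hole ht hα hα1 hH M N (hJ.2.2.1 α hαJ)

/-- The conditional length of the cylinder with first digit `a + 1`. -/
noncomputable def branchRatio (r : ℝ) (a : ℕ) : ℝ := (1 + r) / ((a + 1 + r) * (a + 2 + r))

theorem branchRatio_pos {r : ℝ} (h0 : 0 ≤ r) (a : ℕ) : 0 < branchRatio r a := by
  unfold branchRatio
  positivity

theorem branchRatio_eq_sub {r : ℝ} (h0 : 0 ≤ r) (a : ℕ) :
    branchRatio r a = (1 + r) / (a + 1 + r) - (1 + r) / ((a + 1 : ℕ) + 1 + r) := by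
  unfold branchRatio
  push_cast
  field_simp
  ring

theorem branchRatio_le_half {r : ℝ} (h0 : 0 ≤ r) (a : ℕ) :
    branchRatio r a ≤ 1 / 2 := by
  unfold branchRatio
  rw [div_le_div_iff₀ (by positivity) (by norm_num)]
  have : (0 : ℝ) ≤ a := Nat.cast_nonneg a
  nlinarith [mul_nonneg this h0, mul_nonneg this this]

theorem branchRatio_le {r : ℝ} (h0 : 0 ≤ r) (h1 : r ≤ 1) (a : ℕ) :
    branchRatio r a ≤ 2 / (a + 1 : ℝ) ^ 2 := by
  unfold branchRatio
  rw [div_le_div_iff₀ (by positivity) (by positivity)]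
  have : (0 : ℝ) ≤ a := Nat.cast_nonneg a
  have h2 : ((a : ℝ) + 1) ^ 2 ≤ (a + 1 + r) * (a + 2 + r) := by nlinarith
  have h3 : 0 ≤ ((a : ℝ) + 1) ^ 2 := by positivity
  nlinarith

theorem branchRatio_zero {r : ℝ} (h0 : 0 ≤ r) : branchRatio r 0 = 1 / (2 + r) := by
  unfold branchRatio
  push_cast
  field_simp
  ring

theorem sum_branchRatio {r : ℝ} (h0 : 0 ≤ r) (m : ℕ) :
    ∑ a ∈ Finset.range m, branchRatio r a = 1 - (1 + r) / (m + 1 + r) := by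
  have h : (1 + r) / ((0 : ℕ) + 1 + r) = 1 := by
    push_cast
    rw [zero_add, div_self (by positivity)]
  rw [Finset.sum_congr rfl fun a _ => branchRatio_eq_sub h0 a,
    Finset.sum_range_sub' (fun a : ℕ => (1 + r) / (a + 1 + r)), h]

/-- Weights making the pressure of the system with bounded runs of the digit `1` negative. -/
noncomputable def runWeight (n j : ℕ) : ℝ := 1 - (1 / 4 : ℝ) ^ (n - j)

theorem runWeight_nonneg (n j : ℕ) : 0 ≤ runWeight n j :=
  sub_nonneg.2 (pow_le_one₀ (by norm_num) (by norm_num))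

theorem runWeight_le_one (n j : ℕ) : runWeight n j ≤ 1 :=
  sub_le_self _ (by positivity)

theorem half_le_runWeight {n j : ℕ} (h : j < n) : 1 / 2 ≤ runWeight n j := by
  unfold runWeight
  have : (1 / 4 : ℝ) ^ (n - j) ≤ (1 / 4) ^ 1 :=
    pow_le_pow_of_le_one (by norm_num) (by norm_num) (by omega)
  linarith

theorem rpow_one_sub_le {p θ : ℝ} (hp : 0 ≤ p) (h0 : 0 ≤ θ) (h1 : θ ≤ 1) :
    p ^ (1 - θ / 4) ≤ p + θ * p ^ (3 / 4 : ℝ) := by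
  have h := Real.geom_mean_le_arith_mean2_weighted (sub_nonneg.2 h1) h0 hp
    (Real.rpow_nonneg hp (3 / 4 : ℝ)) (by ring)
  rw [← Real.rpow_mul hp, ← Real.rpow_add_of_nonneg hp (by linarith) (by positivity)] at h
  have he : 1 - θ + 3 / 4 * θ = 1 - θ / 4 := by ring
  rw [he] at h
  nlinarith

/-- The run length of the digit `1` after reading the digit `a + 1`. -/
def nextRun (j a : ℕ) : ℕ := if a = 0 then j + 1 else 0

theorem sum_runWeight_le {n : ℕ} {r : ℝ} (h0 : 0 ≤ r) (h1 : r ≤ 1) {j : ℕ} (hj : j < n) (m : ℕ) :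
    ∑ a ∈ Finset.range m, runWeight n (nextRun j a) * branchRatio r a ≤
      runWeight n j - (1 / 4) ^ n / 3 := by
  have hmono : ∑ a ∈ Finset.range m, runWeight n (nextRun j a) * branchRatio r a ≤
      ∑ a ∈ Finset.range (m + 1), runWeight n (nextRun j a) * branchRatio r a := by
    rw [Finset.sum_range_succ]
    have := mul_nonneg (runWeight_nonneg n (nextRun j m)) (branchRatio_pos h0 m).le
    linarith
  refine hmono.trans ?_
  have hs := sum_branchRatio h0 (m + 1)
  rw [Finset.sum_range_succ'] at hs ⊢
  have hle : ∑ a ∈ Finset.range m, runWeight n (nextRun j (a + 1)) * branchRatio r (a + 1) ≤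
      ∑ a ∈ Finset.range m, branchRatio r (a + 1) := by
    refine Finset.sum_le_sum fun a _ => ?_
    have := branchRatio_pos h0 (a + 1)
    nlinarith [runWeight_le_one n (nextRun j (a + 1))]
  have hp : 1 / 3 ≤ branchRatio r 0 := by
    rw [branchRatio_zero h0]
    exact one_div_le_one_div_of_le (by linarith) (by linarith)
  have hfrac : 0 ≤ (1 + r) / (((m + 1 : ℕ) : ℝ) + 1 + r) := by positivity
  obtain ⟨d, rfl⟩ : ∃ d, n = j + 1 + d := ⟨n - (j + 1), by omega⟩
  have e1 : j + 1 + d - (j + 1) = d := by omega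
  have e2 : j + 1 + d - j = d + 1 := by omega
  simp only [nextRun, if_true, runWeight, e1, e2] at hle ⊢
  have h4 : (1 / 4 : ℝ) ^ (j + 1 + d) ≤ (1 / 4) ^ (d + 1) :=
    pow_le_pow_of_le_one (by norm_num) (by norm_num) (by omega)
  have h5 : (1 / 4 : ℝ) ^ (d + 1) = (1 / 4) ^ d / 4 := by rw [pow_succ]; ring
  have h6 : (0 : ℝ) < (1 / 4) ^ d := by positivity
  nlinarith

theorem summable_branchBound :
    Summable fun a : ℕ => (2 / ((a : ℝ) + 1) ^ 2) ^ (3 / 4 : ℝ) := by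
  have h : Summable fun a : ℕ => (2 : ℝ) ^ (3 / 4 : ℝ) * (1 / ((a + 1 : ℕ) : ℝ) ^ (3 / 2 : ℝ)) :=
    ((summable_nat_add_iff 1).2 (Real.summable_one_div_nat_rpow.2 (by norm_num))).mul_left _
  refine h.congr fun a => ?_
  have ha : (0 : ℝ) ≤ (a : ℝ) + 1 := by positivity
  rw [Real.div_rpow (by norm_num) (by positivity), ← Real.rpow_natCast, ← Real.rpow_mul ha]
  push_cast
  rw [mul_one_div]
  norm_num

theorem exists_exponent (n : ℕ) : ∃ s : ℝ, 0 < s ∧ s < 1 ∧ ∀ r : ℝ, 0 ≤ r → r ≤ 1 → ∀ j < n,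
    ∀ m, ∑ a ∈ Finset.range m, runWeight n (nextRun j a) * branchRatio r a ^ s ≤
      runWeight n j := by
  set C := ∑' a : ℕ, (2 / ((a : ℝ) + 1) ^ 2) ^ (3 / 4 : ℝ) with hC
  have hC0 : 0 ≤ C := tsum_nonneg fun a => by positivity
  set θ : ℝ := (1 / 4) ^ n / 3 / (C + 1) with hθ
  have hpow : (1 / 4 : ℝ) ^ n ≤ 1 := pow_le_one₀ (by norm_num) (by norm_num)
  have hθ0 : 0 < θ := by positivity
  have hθ1 : θ ≤ 1 := by
    rw [hθ, div_le_one (by positivity)]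
    linarith
  have hθC : θ * C ≤ (1 / 4) ^ n / 3 := by
    have : θ * (C + 1) = (1 / 4) ^ n / 3 := div_mul_cancel₀ _ (by positivity)
    nlinarith
  refine ⟨1 - θ / 4, by linarith, by linarith, fun r h0 h1 j hj m => ?_⟩
  have hterm : ∀ a ∈ Finset.range m,
      runWeight n (nextRun j a) * branchRatio r a ^ (1 - θ / 4) ≤
      runWeight n (nextRun j a) * branchRatio r a +
        θ * (2 / ((a : ℝ) + 1) ^ 2) ^ (3 / 4 : ℝ) := by
    intro a _
    have hp := branchRatio_pos h0 a
    have hb : branchRatio r a ^ (3 / 4 : ℝ) ≤ (2 / ((a : ℝ) + 1) ^ 2) ^ (3 / 4 : ℝ) :=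
      Real.rpow_le_rpow hp.le (branchRatio_le h0 h1 a) (by norm_num)
    have hb0 : 0 ≤ branchRatio r a ^ (3 / 4 : ℝ) := by positivity
    have hw0 := runWeight_nonneg n (nextRun j a)
    have hw1 := runWeight_le_one n (nextRun j a)
    have h2 := mul_le_mul_of_nonneg_left (rpow_one_sub_le hp.le hθ0.le hθ1) hw0
    have h3 : runWeight n (nextRun j a) * (θ * branchRatio r a ^ (3 / 4 : ℝ)) ≤
        θ * branchRatio r a ^ (3 / 4 : ℝ) :=
      mul_le_of_le_one_left (by positivity) hw1
    have h4 := mul_le_mul_of_nonneg_left hb hθ0.le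
    linarith
  refine (Finset.sum_le_sum hterm).trans ?_
  rw [Finset.sum_add_distrib, ← Finset.mul_sum]
  have h5 := sum_runWeight_le h0 h1 hj m
  have h6 : ∑ a ∈ Finset.range m, (2 / ((a : ℝ) + 1) ^ 2) ^ (3 / 4 : ℝ) ≤ C :=
    summable_branchBound.sum_le_tsum _ fun a _ => by positivity
  have h7 := mul_le_mul_of_nonneg_left h6 hθ0.le
  linarith

/-- The points all of whose runs of the digit `1` are shorter than `n`, the initial one being
shorter than `n - j`. -/
def boundedRuns (n j : ℕ) : Set ℝ :=
  {x | x ∈ irrUnit ∧ (∀ k, ∃ i < n, gauss^[k + i] x < 1 / 2) ∧ ∃ i, i + j < n ∧ gauss^[i] x < 1 / 2}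

theorem boundedRuns_step {n j : ℕ} {x : ℝ} (hx : x ∈ boundedRuns n j) :
    ∃ a : ℕ, nextRun j a < n ∧ ∃ y ∈ boundedRuns n (nextRun j a), x = 1 / (a + 1 + y) := by
  obtain ⟨hi, hk, i, hij, hlt⟩ := hx
  have hy := gauss_mem hi
  obtain ⟨c, hc⟩ := gauss_spec x
  have hx1 : 1 < 1 / x := by
    rw [lt_div_iff₀ hi.2.1]
    linarith [hi.2.2]
  have hc0 : 0 < c := by
    have : (0 : ℝ) < c := by linarith [hy.2.2]
    exact_mod_cast this
  obtain ⟨a, rfl⟩ : ∃ a : ℕ, c = a + 1 := ⟨(c - 1).toNat, by omega⟩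
  push_cast at hc
  have hxe : x = 1 / (a + 1 + gauss x) := by rw [← hc, one_div_one_div]
  have hshift : ∀ k, ∃ i < n, gauss^[k + i] (gauss x) < 1 / 2 := by
    intro k
    obtain ⟨i, hi1, hi2⟩ := hk (k + 1)
    refine ⟨i, hi1, ?_⟩
    rw [← Function.iterate_succ_apply]
    convert hi2 using 3
    omega
  refine ⟨a, ?_, gauss x, ⟨hy, hshift, ?_⟩, hxe⟩
  all_goals unfold nextRun; split_ifs with ha
  all_goals try omega
  all_goals try subst ha
  · rcases i with _ | i
    · exfalso
      simp only [Function.iterate_zero, id] at hlt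
      rw [hxe, Nat.cast_zero, zero_add, div_lt_div_iff₀ (by linarith [hy.2.1]) (by norm_num)] at hlt
      linarith [hy.2.2]
    · omega
  · rcases i with _ | i
    · exfalso
      simp only [Function.iterate_zero, id] at hlt
      rw [hxe, Nat.cast_zero, zero_add, div_lt_div_iff₀ (by linarith [hy.2.1]) (by norm_num)] at hlt
      linarith [hy.2.2]
    · exact ⟨i, by omega, by rwa [← Function.iterate_succ_apply]⟩
  · obtain ⟨i, hi1, hi2⟩ := hshift 0
    exact ⟨i, by omega, by simpa using hi2⟩

/-- The Möbius map with the given coefficients. -/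
noncomputable def mobius (p p' q q' x : ℝ) : ℝ := (p + p' * x) / (q + q' * x)

theorem mobius_branch {p p' q q' c y : ℝ} (h : c + y ≠ 0) :
    mobius p p' q q' (1 / (c + y)) = mobius (p * c + p') p (q * c + q') q y := by
  unfold mobius
  rw [← mul_div_mul_right _ _ h]
  congr 1 <;> field_simp <;> ring

theorem abs_mobius_sub_le {p p' q q' x y : ℝ} (hdet : |p * q' - p' * q| = 1) (hq : 0 < q)
    (hq' : 0 ≤ q') (hx : x ∈ Icc (0 : ℝ) 1) (hy : y ∈ Icc (0 : ℝ) 1) :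
    |mobius p p' q q' x - mobius p p' q q' y| ≤ 1 / (q * (q + q')) := by
  wlog hxy : x ≤ y generalizing x y
  · rw [abs_sub_comm]
    exact this hy hx (le_of_not_ge hxy)
  have h1 : 0 < q + q' * x := by nlinarith [mul_nonneg hq' hx.1]
  have h2 : 0 < q + q' * y := by nlinarith [mul_nonneg hq' hy.1]
  have he : mobius p p' q q' x - mobius p p' q q' y =
      (p * q' - p' * q) * (y - x) / ((q + q' * x) * (q + q' * y)) := by
    unfold mobius
    rw [div_sub_div _ _ h1.ne' h2.ne']
    congr 1
    ring
  rw [he, abs_div, abs_mul, hdet, one_mul, abs_of_nonneg (sub_nonneg.2 hxy),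
    abs_of_pos (by positivity), div_le_div_iff₀ (by positivity) (by positivity), one_mul]
  have h3 := mul_nonneg hq' hx.1
  have h4 := mul_nonneg hq' hy.1
  have h5 : (y - x) * (q * q) ≤ q * q :=
    mul_le_of_le_one_left (by positivity) (by linarith [hx.1, hy.2])
  nlinarith [mul_nonneg hq.le h3, mul_nonneg hq.le h4, mul_nonneg h3 h4]

theorem branchRatio_div {q q' : ℝ} (hq : 0 < q) (hq' : 0 ≤ q') (a : ℕ) :
    1 / ((q * (a + 1) + q') * (q * (a + 1) + q' + q)) =
      1 / (q * (q + q')) * branchRatio (q' / q) a := by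
  unfold branchRatio
  field_simp
  ring

theorem boundedRuns_subset_Icc {n j : ℕ} : boundedRuns n j ⊆ Icc 0 1 :=
  fun _ hx => ⟨hx.1.2.1.le, hx.1.2.2.le⟩

theorem pre_mobius_image_le {n : ℕ} {s : ℝ} (hs : 0 < s)
    (hsum : ∀ r : ℝ, 0 ≤ r → r ≤ 1 → ∀ j < n, ∀ m,
      ∑ a ∈ Finset.range m, runWeight n (nextRun j a) * branchRatio r a ^ s ≤ runWeight n j)
    {ε : ℝ} (N : ℕ) : ∀ (p p' q q' : ℝ) (j : ℕ), |p * q' - p' * q| = 1 → 1 ≤ q →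
      0 ≤ q' → q' ≤ q → j < n → 1 / (q * (q + q')) ≤ ε * 2 ^ N →
      OuterMeasure.mkMetric'.pre (fun A : Set ℝ => Metric.ediam A ^ s) (ENNReal.ofReal ε)
        (mobius p p' q q' '' boundedRuns n j) ≤
      ENNReal.ofReal (2 * runWeight n j * (1 / (q * (q + q'))) ^ s) := by
  induction N with
  | zero =>
    intro p p' q q' j hdet hq hq' hqq hj hlen
    have hq0 : 0 < q := by linarith
    have hl : 0 < 1 / (q * (q + q')) := by positivity
    have hdiam : Metric.ediam (mobius p p' q q' '' boundedRuns n j) ≤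
        ENNReal.ofReal (1 / (q * (q + q'))) := by
      refine Metric.ediam_le ?_
      rintro _ ⟨x, hx, rfl⟩ _ ⟨y, hy, rfl⟩
      rw [edist_dist, Real.dist_eq]
      exact ENNReal.ofReal_le_ofReal (abs_mobius_sub_le hdet hq0 hq' (boundedRuns_subset_Icc hx)
        (boundedRuns_subset_Icc hy))
    refine (OuterMeasure.mkMetric'.pre_le (hdiam.trans (ENNReal.ofReal_le_ofReal ?_))).trans ?_
    · simpa using hlen
    · refine (ENNReal.rpow_le_rpow hdiam hs.le).trans ?_
      rw [ENNReal.ofReal_rpow_of_pos hl]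
      refine ENNReal.ofReal_le_ofReal ?_
      have := half_le_runWeight hj
      have h2 : 0 ≤ (1 / (q * (q + q'))) ^ s := by positivity
      nlinarith
  | succ N ih =>
    intro p p' q q' j hdet hq hq' hqq hj hlen
    have hq0 : 0 < q := by linarith
    have hl : 0 < 1 / (q * (q + q')) := by positivity
    have hr0 : 0 ≤ q' / q := by positivity
    have hr1 : q' / q ≤ 1 := by rw [div_le_one hq0]; exact hqq
    have hcover : mobius p p' q q' '' boundedRuns n j ⊆ ⋃ a : ℕ,
        (if nextRun j a < n then
          mobius (p * (a + 1) + p') p (q * (a + 1) + q') q '' boundedRuns n (nextRun j a)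
        else ∅) := by
      rintro _ ⟨x, hx, rfl⟩
      obtain ⟨a, ha, y, hy, rfl⟩ := boundedRuns_step hx
      refine mem_iUnion.2 ⟨a, ?_⟩
      rw [if_pos ha]
      refine ⟨y, hy, (mobius_branch ?_).symm⟩
      have := hy.1.2.1
      positivity
    refine (measure_mono hcover).trans ((measure_iUnion_le _).trans ?_)
    refine ENNReal.tsum_le_of_sum_range_le fun m => ?_
    have hterm : ∀ a ∈ Finset.range m,
        OuterMeasure.mkMetric'.pre (fun A : Set ℝ => Metric.ediam A ^ s) (ENNReal.ofReal ε)
          (if nextRun j a < n then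
            mobius (p * (a + 1) + p') p (q * (a + 1) + q') q '' boundedRuns n (nextRun j a)
          else ∅) ≤
        ENNReal.ofReal (2 * (1 / (q * (q + q'))) ^ s *
          (runWeight n (nextRun j a) * branchRatio (q' / q) a ^ s)) := by
      intro a _
      split_ifs with ha
      · have hb := branchRatio_pos hr0 a
        have ha0 : (0 : ℝ) ≤ a := Nat.cast_nonneg a
        refine (ih _ _ _ _ _ ?_ ?_ hq0.le ?_ ha ?_).trans (ENNReal.ofReal_le_ofReal ?_)
        · rw [← hdet, abs_sub_comm]
          congr 1
          ring
        · nlinarith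
        · nlinarith
        · rw [branchRatio_div hq0 hq']
          have := branchRatio_le_half hr0 a
          rw [pow_succ] at hlen
          nlinarith
        · rw [branchRatio_div hq0 hq', Real.mul_rpow hl.le hb.le]
          apply le_of_eq
          ring
      · simp
    refine (Finset.sum_le_sum hterm).trans ?_
    rw [← ENNReal.ofReal_sum_of_nonneg]
    · refine ENNReal.ofReal_le_ofReal ?_
      rw [← Finset.mul_sum]
      have h2 : 0 ≤ 2 * (1 / (q * (q + q'))) ^ s := by positivity
      have := mul_le_mul_of_nonneg_left (hsum _ hr0 hr1 j hj m) h2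
      linarith
    · intro a _
      have hb := branchRatio_pos hr0 a
      have := runWeight_nonneg n (nextRun j a)
      positivity

theorem exists_dimH_mobius_image_le {n : ℕ} (hn : 0 < n) : ∃ s : ℝ, 0 < s ∧ s < 1 ∧
    ∀ p p' q q' : ℝ, |p * q' - p' * q| = 1 → 1 ≤ q → 0 ≤ q' → q' ≤ q →
      dimH (mobius p p' q q' '' boundedRuns n 0) ≤ ENNReal.ofReal s := by
  obtain ⟨s, hs0, hs1, hsum⟩ := exists_exponent n
  refine ⟨s, hs0, hs1, fun p p' q q' hdet hq hq' hqq => ?_⟩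
  refine dimH_le_of_hausdorffMeasure_ne_top (d := s.toNNReal) (ne_top_of_le_ne_top
    (ENNReal.ofReal_ne_top (r := 2 * runWeight n 0 * (1 / (q * (q + q'))) ^ s)) ?_)
  rw [Real.coe_toNNReal _ hs0.le, Measure.hausdorffMeasure, ← OuterMeasure.coe_mkMetric,
    OuterMeasure.mkMetric, OuterMeasure.mkMetric', OuterMeasure.iSup_apply]
  refine iSup_le fun r => ?_
  rw [OuterMeasure.iSup_apply]
  refine iSup_le fun hr => ?_
  obtain ⟨ε, hε, hεr⟩ : ∃ ε : ℝ, 0 < ε ∧ ENNReal.ofReal ε ≤ r := by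
    rcases eq_or_ne r ⊤ with rfl | hr'
    · exact ⟨1, one_pos, le_top⟩
    · exact ⟨r.toReal, ENNReal.toReal_pos hr.ne' hr', (ENNReal.ofReal_toReal hr').le⟩
  obtain ⟨N, hN⟩ := pow_unbounded_of_one_lt (1 / (q * (q + q')) / ε) (one_lt_two)
  refine le_trans ?_ (pre_mobius_image_le (ε := ε) hs0 hsum N p p' q q' 0 hdet hq hq' hqq hn ?_)
  · exact OuterMeasure.mkMetric'.mono_pre _ hεr _
  · rw [div_lt_iff₀ hε] at hN
    linarith

theorem dimH_algebraic : dimH {x : ℝ | IsAlgebraic ℤ x} = 0 :=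
  (Algebraic.countable ℤ ℝ).dimH_zero

theorem inv_one_add_sub_g {y : ℝ} (hy : 0 ≤ y) :
    1 / (1 + y) - g = (g - y) * (g / (1 + y)) := by
  have := g_sq
  field_simp
  linarith

theorem abs_sub_g_le {m : ℕ} : ∀ {z : ℝ}, z ∈ irrUnit → (∀ i < m, 1 / 2 < gauss^[i] z) →
    |z - g| ≤ g ^ m := by
  have hg := g_gt
  have hg' := g_lt
  induction m with
  | zero =>
    intro z hz _
    rw [pow_zero, abs_le]
    constructor <;> linarith [hz.2.1, hz.2.2]
  | succ m ih =>
    intro z hz h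
    have hy := gauss_mem hz
    have h0 := h 0 (by omega)
    rw [Function.iterate_zero, id] at h0
    have hzy : z = 1 / (1 + gauss z) := by
      have := hz.2.1.ne'
      rw [gauss_of_half_lt h0 hz.2.2]
      field_simp
      ring
    have h1 := ih hy fun i hi => by
      rw [← Function.iterate_succ_apply]
      exact h (i + 1) (by omega)
    rw [hzy, inv_one_add_sub_g hy.2.1.le, abs_mul, abs_sub_comm, pow_succ]
    have h2 : |g / (1 + gauss z)| ≤ g := by
      rw [abs_of_nonneg (div_nonneg (by linarith) (by linarith [hy.2.1]))]
      exact div_le_self (by linarith) (by linarith [hy.2.1])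
    exact mul_le_mul h1 h2 (abs_nonneg _) (by positivity)

theorem hole_of_abs_sub_g_le {α δ z : ℝ} (hδ : 0 < δ) (hα : g + δ < α) (hα1 : α < 1)
    (hz : |z - g| < δ / 4) : Hole α z := by
  have hg := g_gt
  have hg2 := g_sq
  rw [abs_lt] at hz
  refine Or.inr ⟨?_, by linarith⟩
  rw [div_lt_iff₀ (by linarith)]
  nlinarith [mul_pos hδ (sub_pos.2 hα)]

theorem exists_pow_g_lt {ε : ℝ} (hε : 0 < ε) : ∃ m : ℕ, g ^ m < ε :=
  exists_pow_lt_of_lt_one hε (by linarith [g_lt])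

theorem gauss_mem_boundedRuns {α δ : ℝ} (hδ : 0 < δ) {m : ℕ} (hm : g ^ m < δ / 4)
    (ht : Transcendental ℤ α) (hα : α ∈ E ∩ Ioo (g + δ) 1) :
    gauss (1 - α) ∈ boundedRuns (m + 3) 0 := by
  have hg := g_gt
  obtain ⟨⟨-, hE⟩, hα0, hα1⟩ := hα
  have hi := ht.irrational_real
  have hmem := gauss_mem (one_sub_mem_irrUnit hi (by linarith) hα1)
  have key : ∀ k, ∃ i < m + 3, gauss^[k + i] (gauss (1 - α)) < 1 / 2 := by
    intro k
    by_contra! hcon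
    obtain ⟨M, N, hMN⟩ := exists_matching (k₀ := k + 1) hi (by linarith) hα1 fun i hi3 => by
      refine hole_of_abs_sub_g_le hδ hα0 hα1 (lt_of_le_of_lt (abs_sub_g_le ?_ ?_) hm)
      · exact iterate_gauss_mem (one_sub_mem_irrUnit hi (by linarith) hα1) _
      · intro l hl
        have h1 := hcon (i + l) (by omega)
        have h2 := half_ne (iterate_gauss_mem hmem (k + (i + l))).1
        have h3 : gauss^[l] (gauss^[k + 1 + i] (1 - α)) =
            gauss^[k + (i + l)] (gauss (1 - α)) := by
          rw [← Function.iterate_add_apply, ← Function.iterate_succ_apply]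
          congr 2
          omega
        rw [h3]
        exact lt_of_le_of_ne h1 h2.symm
    exact hE (mem_matchingSet_of_iterate_eq ht (by linarith) hα1 hMN)
  refine ⟨hmem, key, ?_⟩
  simpa using key 0

theorem dimH_bifurcation_lt_one {δ : ℝ} (hδ : 0 < δ) : dimH (E ∩ Ioo (g + δ) 1) < 1 := by
  have hg := g_gt
  obtain ⟨m, hm⟩ := exists_pow_g_lt (show 0 < δ / 4 by linarith)
  obtain ⟨s, hs0, hs1, hs⟩ := exists_dimH_mobius_image_le (n := m + 3) (by omega)
  have hsub : E ∩ Ioo (g + δ) 1 ⊆ {x : ℝ | IsAlgebraic ℤ x} ∪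
      ⋃ a : ℕ, mobius a 1 (a + 1) 1 '' boundedRuns (m + 3) 0 := by
    intro α hα
    by_cases ht : IsAlgebraic ℤ α
    · exact Or.inl ht
    refine Or.inr (mem_iUnion.2 ?_)
    have hb := gauss_mem_boundedRuns hδ hm ht hα
    have hy := hb.1.2
    obtain ⟨c, hc⟩ := gauss_spec (1 - α)
    have hα0 := hα.2.1
    have hα1 := hα.2.2
    have hx1 : 1 < 1 / (1 - α) := by
      rw [lt_div_iff₀ (by linarith)]
      linarith
    have hc0 : 0 < c := by
      have : (0 : ℝ) < c := by linarith
      exact_mod_cast this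
    obtain ⟨a, rfl⟩ : ∃ a : ℕ, c = a + 1 := ⟨(c - 1).toNat, by omega⟩
    push_cast at hc
    refine ⟨a, _, hb, ?_⟩
    have hpos : (0 : ℝ) < a + 1 + gauss (1 - α) := by
      have := hy.1
      positivity
    have h1 : 1 - α = 1 / (a + 1 + gauss (1 - α)) := by rw [← hc, one_div_one_div]
    unfold mobius
    rw [one_mul]
    have h2 : α = 1 - 1 / (a + 1 + gauss (1 - α)) := by linarith
    rw [eq_comm]
    refine h2.trans ?_
    rw [eq_div_iff hpos.ne', sub_mul, div_mul_cancel₀ _ hpos.ne']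
    ring
  refine lt_of_le_of_lt (dimH_mono hsub) ?_
  rw [dimH_union, dimH_algebraic, dimH_iUnion]
  refine lt_of_le_of_lt (max_le zero_le (iSup_le fun a => ?_)) (ENNReal.ofReal_lt_one.2 hs1)
  refine hs _ _ _ _ ?_ (by simp) zero_le_one (by simp)
  norm_num

/-- The first `n` letters of a sequence. -/
def initSeg (b : ℕ → ℕ) (n : ℕ) : List ℕ := (List.range n).map b

theorem initSeg_succ (b : ℕ → ℕ) (n : ℕ) : initSeg b (n + 1) = initSeg b n ++ [b n] := by
  simp [initSeg, List.range_succ]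

theorem length_initSeg (b : ℕ → ℕ) (n : ℕ) : (initSeg b n).length = n := by
  simp [initSeg]

theorem initSeg_congr {b b' : ℕ → ℕ} {n : ℕ} (h : ∀ i < n, b i = b' i) :
    initSeg b n = initSeg b' n :=
  List.map_congr_left fun i hi => h i (List.mem_range.1 hi)

/-- The sequences with letters in prescribed sets. -/
def admissible (A : ℕ → Finset ℕ) : Set (ℕ → ℕ) := {b | ∀ n, b n ∈ A n}

theorem exists_path {A : ℕ → Finset ℕ} {P : List ℕ → Prop} (h0 : P [])
    (hP : ∀ w, P w → ∃ a ∈ A w.length, P (w ++ [a])) :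
    ∃ b ∈ admissible A, ∀ n, P (initSeg b n) := by
  choose! f hf1 hf2 using hP
  let W : ℕ → List ℕ := fun n => n.rec [] fun _ w => w ++ [f w]
  have hW : ∀ n, W n = initSeg (fun k => f (W k)) n ∧ P (W n) := by
    intro n
    induction n with
    | zero => exact ⟨rfl, h0⟩
    | succ n ih =>
      refine ⟨?_, hf2 _ ih.2⟩
      rw [initSeg_succ, ← ih.1]
  refine ⟨fun k => f (W k), fun n => ?_, fun n => (hW n).1 ▸ (hW n).2⟩
  have := hf1 _ (hW n).2
  rwa [(hW n).1, length_initSeg, ← (hW n).1] at this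

theorem sum_restricted_mass_le {A : ℕ → Finset ℕ} (m : List ℕ → ℝ≥0∞) (v : ℕ → List ℕ)
    (w : List ℕ) :
    ∑ a ∈ A w.length, ∑' i, (if w ++ [a] <+: v i then m (v i) else 0) ≤
      ∑' i, if w <+: v i then m (v i) else 0 := by
  rw [← Summable.tsum_finsetSum fun _ _ => ENNReal.summable]
  refine ENNReal.tsum_le_tsum fun i => ?_
  by_cases hw : ∃ a ∈ A w.length, w ++ [a] <+: v i
  · obtain ⟨a, ha, hav⟩ := hw
    rw [Finset.sum_eq_single a, if_pos hav, if_pos ((List.prefix_append _ _).trans hav)]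
    · intro c _ hca
      refine if_neg fun hcv => hca ?_
      have := List.prefix_of_prefix_length_le hcv hav (by simp)
      have := this.eq_of_length (by simp)
      simpa using this
    · exact fun h => absurd ha h
  · push Not at hw
    rw [Finset.sum_eq_zero fun a ha => if_neg (hw a ha)]
    exact zero_le

theorem exists_word_of_cover {A : ℕ → Finset ℕ} (hA : ∀ n, (A n).Nonempty)
    {m : List ℕ → ℝ≥0∞} {π : (ℕ → ℕ) → ℝ} {C : ℝ≥0∞} {s : ℝ} (hs : 0 < s)
    (hsep : ∀ b ∈ admissible A, ∀ b' ∈ admissible A, ∀ n, (∀ i < n, b i = b' i) → b n ≠ b' n →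
      m (initSeg b n) ≤ C * edist (π b) (π b') ^ s)
    (hlim : ∀ b ∈ admissible A, ∀ ε > 0, ∃ n, m (initSeg b n) ≤ ε)
    (t : Set ℝ) {ε : ℝ≥0∞} (hε : 0 < ε) :
    ∃ w, (∀ b ∈ admissible A, π b ∈ t → initSeg b w.length = w) ∧
      m w ≤ C * Metric.ediam t ^ s + ε := by
  classical
  by_cases ht : ∃ b ∈ admissible A, π b ∈ t
  · obtain ⟨b, hb, hbt⟩ := ht
    by_cases hd : ∃ n, ∃ b' ∈ admissible A, π b' ∈ t ∧ b n ≠ b' n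
    · obtain ⟨b', hb', hbt', hne⟩ := Nat.find_spec hd
      have hmin : ∀ i < Nat.find hd, ∀ c ∈ admissible A, π c ∈ t → b i = c i := by
        intro i hi c hc hct
        by_contra hcon
        exact Nat.find_min hd hi ⟨c, hc, hct, hcon⟩
      refine ⟨initSeg b (Nat.find hd), fun c hc hct => ?_, ?_⟩
      · rw [length_initSeg]
        exact initSeg_congr fun i hi => (hmin i hi c hc hct).symm
      · refine (hsep b hb b' hb' _ (fun i hi => hmin i hi b' hb' hbt') hne).trans
          (le_trans ?_ le_self_add)
        gcongr
        exact Metric.edist_le_ediam_of_mem hbt hbt'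
    · push Not at hd
      obtain ⟨n, hn⟩ := hlim b hb ε hε
      refine ⟨initSeg b n, fun c hc hct => ?_, hn.trans le_add_self⟩
      rw [length_initSeg]
      exact initSeg_congr fun i _ => (hd i c hc hct).symm
  · choose b hb using hA
    obtain ⟨n, hn⟩ := hlim b hb ε hε
    exact ⟨initSeg b n, fun c hc hct => absurd ⟨c, hc, hct⟩ ht, hn.trans le_add_self⟩

theorem mass_le_of_cover {A : ℕ → Finset ℕ} (hA : ∀ n, (A n).Nonempty)
    {m : List ℕ → ℝ≥0∞} {π : (ℕ → ℕ) → ℝ} {C : ℝ≥0∞} {s : ℝ} (hs : 0 < s)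
    (hm : ∀ w, m w ≤ ∑ a ∈ A w.length, m (w ++ [a]))
    (hsep : ∀ b ∈ admissible A, ∀ b' ∈ admissible A, ∀ n, (∀ i < n, b i = b' i) → b n ≠ b' n →
      m (initSeg b n) ≤ C * edist (π b) (π b') ^ s)
    (hlim : ∀ b ∈ admissible A, ∀ ε > 0, ∃ n, m (initSeg b n) ≤ ε)
    {t : ℕ → Set ℝ} (ht : π '' admissible A ⊆ ⋃ i, t i) :
    m [] ≤ C * ∑' i, Metric.ediam (t i) ^ s := by
  by_contra! hcon
  rw [← ENNReal.tsum_mul_left] at hcon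
  obtain ⟨ε, hε0, hε⟩ := ENNReal.exists_pos_sum_of_countable' (tsub_pos_of_lt hcon).ne' ℕ
  choose v hv1 hv2 using fun i => exists_word_of_cover hA hs hsep hlim (t i) (hε0 i)
  have htot : ∑' i, m (v i) < m [] := by
    refine lt_of_le_of_lt (ENNReal.tsum_le_tsum hv2) ?_
    rw [ENNReal.tsum_add]
    exact lt_tsub_iff_left.1 hε
  obtain ⟨b, hb, hlt⟩ := exists_path (A := A)
    (P := fun w => ∑' i, (if w <+: v i then m (v i) else 0) < m w) (by simpa using htot)
    fun w hw => by
      by_contra! hall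
      exact absurd hw (not_lt.2 ((hm w).trans
        ((Finset.sum_le_sum hall).trans (sum_restricted_mass_le m v w))))
  obtain ⟨i, hi⟩ := mem_iUnion.1 (ht ⟨b, hb, rfl⟩)
  have hbi := hv1 i b hb hi
  have hlti := hlt (v i).length
  rw [hbi] at hlti
  refine absurd hlti (not_lt.2 ?_)
  have := ENNReal.le_tsum (f := fun k => if v i <+: v k then m (v k) else 0) i
  simpa using this

theorem hausdorffMeasure_image_ne_zero {A : ℕ → Finset ℕ} (hA : ∀ n, (A n).Nonempty)
    {m : List ℕ → ℝ≥0∞} {π : (ℕ → ℕ) → ℝ} {C : ℝ≥0∞} (hC : C ≠ ⊤) {s : ℝ} (hs : 0 < s)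
    (hm : ∀ w, m w ≤ ∑ a ∈ A w.length, m (w ++ [a])) (hm0 : m [] ≠ 0)
    (hsep : ∀ b ∈ admissible A, ∀ b' ∈ admissible A, ∀ n, (∀ i < n, b i = b' i) → b n ≠ b' n →
      m (initSeg b n) ≤ C * edist (π b) (π b') ^ s)
    (hlim : ∀ b ∈ admissible A, ∀ ε > 0, ∃ n, m (initSeg b n) ≤ ε) :
    Measure.hausdorffMeasure s (π '' admissible A) ≠ 0 := by
  intro h0
  rw [Measure.hausdorffMeasure_apply] at h0
  have h1 := (ENNReal.iSup_eq_zero.1 (ENNReal.iSup_eq_zero.1 h0 1) one_pos)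
  have hle : m [] / C ≤ 0 := by
    rw [← h1]
    refine le_iInf fun t => le_iInf fun ht => le_iInf fun _ => ?_
    refine ENNReal.div_le_of_le_mul' ((mass_le_of_cover hA hs hm hsep hlim ht).trans ?_)
    gcongr with i
    rcases (t i).eq_empty_or_nonempty with he | hne
    · rw [he, Metric.ediam_empty, ENNReal.zero_rpow_of_pos hs]
      exact zero_le
    · exact le_iSup (fun _ : (t i).Nonempty => Metric.ediam (t i) ^ s) hne
  exact absurd (nonpos_iff_eq_zero.1 hle) (ENNReal.div_pos hm0 hC).ne'

theorem exists_cfTail (b : ℕ → ℕ) :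
    ∃ y : ℕ → ℝ, ∀ k, y k ∈ Icc (0 : ℝ) 1 ∧ y k * (b k + 1 + y (k + 1)) = 1 := by
  let t : ℕ → Set (ℕ → ℝ) := fun n =>
    univ.pi (fun _ => Icc (0 : ℝ) 1) ∩ {y | ∀ k < n, y k * (b k + 1 + y (k + 1)) = 1}
  have hne : ∀ (n : ℕ) (b : ℕ → ℕ), ∃ y : ℕ → ℝ, (∀ k, y k ∈ Icc (0 : ℝ) 1) ∧
      ∀ k < n, y k * (b k + 1 + y (k + 1)) = 1 := by
    intro n
    induction n with
    | zero => exact fun b => ⟨fun _ => 0, fun _ => by simp, by simp⟩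
    | succ n ih =>
      intro b
      obtain ⟨y, hy, hn⟩ := ih fun k => b (k + 1)
      have hpos : (1 : ℝ) ≤ b 0 + 1 + y 0 := by
        have := (hy 0).1
        have : (0 : ℝ) ≤ b 0 := Nat.cast_nonneg _
        linarith
      refine ⟨fun k => k.casesOn (1 / (b 0 + 1 + y 0)) y, fun k => ?_, fun k hk => ?_⟩
      · rcases k with _ | k
        · exact ⟨div_nonneg zero_le_one (by linarith), (div_le_one (by linarith)).2 hpos⟩
        · exact hy k
      · rcases k with _ | k
        · exact one_div_mul_cancel (by linarith)
        · exact hn k (by omega)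
  have hcl : ∀ n, IsClosed (t n) := by
    intro n
    refine (isClosed_set_pi fun _ _ => isClosed_Icc).inter ?_
    simp only [ofPred_forall]
    exact isClosed_iInter fun k => isClosed_iInter fun _ =>
      isClosed_eq (by fun_prop) continuous_const
  obtain ⟨y, hy⟩ := IsCompact.nonempty_iInter_of_sequence_nonempty_isCompact_isClosed t
    (fun n y hy => ⟨hy.1, fun k hk => hy.2 k (by omega)⟩)
    (fun n => by
      obtain ⟨y, h1, h2⟩ := hne n b
      exact ⟨y, fun k _ => h1 k, h2⟩)
    ((isCompact_univ_pi fun _ => isCompact_Icc).inter_right (by simp)) hcl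
  rw [mem_iInter] at hy
  exact ⟨y, fun k => ⟨(hy 0).1 k trivial, (hy (k + 1)).2 k (by omega)⟩⟩

/-- The tails of the continued fraction with digits `b k + 1`. -/
noncomputable def cfTail (b : ℕ → ℕ) : ℕ → ℝ := (exists_cfTail b).choose

theorem cfTail_mul (b : ℕ → ℕ) (k : ℕ) : cfTail b k * (b k + 1 + cfTail b (k + 1)) = 1 :=
  ((exists_cfTail b).choose_spec k).2

theorem cfTail_nonneg (b : ℕ → ℕ) (k : ℕ) : 0 ≤ cfTail b k :=
  ((exists_cfTail b).choose_spec k).1.1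

theorem cfTail_pos (b : ℕ → ℕ) (k : ℕ) : 0 < cfTail b k := by
  refine lt_of_le_of_ne (cfTail_nonneg b k) fun h => ?_
  have := cfTail_mul b k
  rw [← h, zero_mul] at this
  exact zero_ne_one this

theorem cfTail_eq (b : ℕ → ℕ) (k : ℕ) : cfTail b k = 1 / (b k + 1 + cfTail b (k + 1)) := by
  have := cfTail_pos b (k + 1)
  rw [eq_div_iff (by positivity), cfTail_mul]

theorem cfTail_lt_one (b : ℕ → ℕ) (k : ℕ) : cfTail b k < 1 := by
  have h1 := cfTail_pos b (k + 1)
  have h2 : (0 : ℝ) ≤ b k := Nat.cast_nonneg _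
  rw [cfTail_eq, div_lt_one (by positivity)]
  linarith

theorem le_cfTail {b : ℕ → ℕ} {k K : ℕ} (h : b k < K) : 1 / ((K : ℝ) + 1) ≤ cfTail b k := by
  have h1 := cfTail_pos b (k + 1)
  have h2 := cfTail_lt_one b (k + 1)
  have h3 : (b k : ℝ) + 1 ≤ K := by exact_mod_cast h
  rw [cfTail_eq]
  exact one_div_le_one_div_of_le (by positivity) (by linarith)

/-- The denominators of the last two convergents of the continued fraction with digits `a + 1`. -/
noncomputable def cfDen (w : List ℕ) : ℝ × ℝ :=
  w.foldl (fun Q a => (Q.1 * (a + 1) + Q.2, Q.1)) (1, 0)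

theorem cfDen_append (w : List ℕ) (a : ℕ) :
    cfDen (w ++ [a]) = ((cfDen w).1 * (a + 1) + (cfDen w).2, (cfDen w).1) := by
  simp [cfDen]

theorem cfDen_bounds (w : List ℕ) :
    0 < (cfDen w).1 ∧ 0 ≤ (cfDen w).2 ∧ (cfDen w).2 ≤ (cfDen w).1 := by
  induction w using List.reverseRecOn with
  | nil => simp [cfDen]
  | append_singleton w a ih =>
    obtain ⟨h1, h2, h3⟩ := ih
    have : (0 : ℝ) ≤ a := Nat.cast_nonneg a
    rw [cfDen_append]
    exact ⟨by positivity, h1.le, by nlinarith⟩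

/-- The length of the cylinder of a word. -/
noncomputable def cylLen (w : List ℕ) : ℝ :=
  1 / ((cfDen w).1 * ((cfDen w).1 + (cfDen w).2))

theorem cylLen_pos (w : List ℕ) : 0 < cylLen w := by
  obtain ⟨h1, h2, -⟩ := cfDen_bounds w
  unfold cylLen
  positivity

theorem cylLen_append (w : List ℕ) (a : ℕ) :
    cylLen (w ++ [a]) = cylLen w * branchRatio ((cfDen w).2 / (cfDen w).1) a := by
  obtain ⟨h1, h2, -⟩ := cfDen_bounds w
  rw [cylLen, cfDen_append]
  exact branchRatio_div h1 h2 a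

theorem ratio_bounds (w : List ℕ) :
    0 ≤ (cfDen w).2 / (cfDen w).1 ∧ (cfDen w).2 / (cfDen w).1 ≤ 1 := by
  obtain ⟨h1, h2, h3⟩ := cfDen_bounds w
  exact ⟨by positivity, (div_le_one h1).2 h3⟩

theorem cylLen_le (w : List ℕ) : cylLen w ≤ (1 / 2) ^ w.length := by
  induction w using List.reverseRecOn with
  | nil => simp [cylLen, cfDen]
  | append_singleton w a ih =>
    rw [cylLen_append, List.length_append, List.length_singleton, pow_succ]
    exact mul_le_mul ih (branchRatio_le_half (ratio_bounds w).1 a)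
      (branchRatio_pos (ratio_bounds w).1 a).le (by positivity)

theorem abs_cfTail_sub_mul {b b' : ℕ → ℕ} {n : ℕ} (h : ∀ i < n, b i = b' i) :
    |cfTail b 0 - cfTail b' 0| *
      (((cfDen (initSeg b n)).1 + (cfDen (initSeg b n)).2 * cfTail b n) *
        ((cfDen (initSeg b n)).1 + (cfDen (initSeg b n)).2 * cfTail b' n)) =
      |cfTail b n - cfTail b' n| := by
  induction n with
  | zero => simp [initSeg, cfDen]
  | succ n ih =>
    have ih := ih fun i hi => h i (by omega)
    obtain ⟨h1, h2, -⟩ := cfDen_bounds (initSeg b n)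
    rw [initSeg_succ, cfDen_append]
    set q := (cfDen (initSeg b n)).1
    set q' := (cfDen (initSeg b n)).2
    have hy := cfTail_pos b (n + 1)
    have hy' := cfTail_pos b' (n + 1)
    have hc : (0 : ℝ) ≤ b n := Nat.cast_nonneg _
    have e1 := cfTail_eq b n
    have e2 := cfTail_eq b' n
    rw [← h n (by omega)] at e2
    rw [e1, e2] at ih
    set u := cfTail b (n + 1)
    set u' := cfTail b' (n + 1)
    have hd : 1 / ((b n : ℝ) + 1 + u) - 1 / (b n + 1 + u') =
        (u' - u) / ((b n + 1 + u) * (b n + 1 + u')) := by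
      rw [div_sub_div _ _ (by positivity) (by positivity)]
      congr 1
      ring
    rw [hd, abs_div, abs_of_pos (show 0 < ((b n : ℝ) + 1 + u) * (b n + 1 + u') by positivity),
      abs_sub_comm u' u, eq_div_iff (by positivity)] at ih
    rw [← ih]
    field_simp
    ring

theorem le_abs_cfTail_sub {b b' : ℕ → ℕ} {n K : ℕ} (hne : b n ≠ b' n)
    (hb : ∀ k, b k < K) (hb' : ∀ k, b' k < K) :
    1 / ((K : ℝ) + 1) ^ 3 ≤ |cfTail b n - cfTail b' n| := by
  wlog hlt : b n < b' n generalizing b b'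
  · rw [abs_sub_comm]
    exact this hne.symm hb' hb (by omega)
  have hy := cfTail_pos b (n + 1)
  have hy1 := cfTail_lt_one b (n + 1)
  have hy' := le_cfTail (hb' (n + 1))
  have hy1' := cfTail_lt_one b' (n + 1)
  refine le_trans ?_ (le_abs_self _)
  rw [cfTail_eq b n, cfTail_eq b' n]
  set u := cfTail b (n + 1)
  set u' := cfTail b' (n + 1)
  have hK : (0 : ℝ) < (K : ℝ) + 1 := by positivity
  have hu' : 0 < u' := lt_of_lt_of_le (by positivity) hy'
  have h1 : (b n : ℝ) + 1 ≤ b' n := by exact_mod_cast hlt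
  have h2 : (b' n : ℝ) + 1 ≤ K := by exact_mod_cast hb' n
  have h0 : (0 : ℝ) ≤ b n := Nat.cast_nonneg _
  rw [div_sub_div _ _ (by positivity) (by positivity), pow_succ, ← div_div,
    div_right_comm]
  have hnum : 1 / ((K : ℝ) + 1) ≤ 1 * (b' n + 1 + u') - (b n + 1 + u) * 1 := by linarith
  have hden : ((b n : ℝ) + 1 + u) * (b' n + 1 + u') ≤ (K + 1) ^ 2 := by
    rw [sq]
    exact mul_le_mul (by linarith) (by linarith) (by positivity) (by positivity)
  exact div_le_div₀ (le_trans (by positivity) hnum) hnum (by positivity) hden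

theorem cylLen_le_abs_sub {b b' : ℕ → ℕ} {n K : ℕ} (h : ∀ i < n, b i = b' i) (hne : b n ≠ b' n)
    (hb : ∀ k, b k < K) (hb' : ∀ k, b' k < K) :
    cylLen (initSeg b n) ≤ 2 * ((K : ℝ) + 1) ^ 3 * |cfTail b 0 - cfTail b' 0| := by
  have h1 := abs_cfTail_sub_mul h
  have h2 := le_abs_cfTail_sub hne hb hb'
  obtain ⟨hq, hq', hqq⟩ := cfDen_bounds (initSeg b n)
  have hy := cfTail_pos b n
  have hy1 := cfTail_lt_one b n
  have hy' := cfTail_pos b' n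
  have hy1' := cfTail_lt_one b' n
  unfold cylLen
  set q := (cfDen (initSeg b n)).1
  set q' := (cfDen (initSeg b n)).2
  rw [← h1, div_le_iff₀ (by positivity)] at h2
  rw [div_le_iff₀ (by positivity)]
  have h3 : (q + q' * cfTail b n) * (q + q' * cfTail b' n) ≤ 2 * (q * (q + q')) := by
    have : (q + q' * cfTail b n) * (q + q' * cfTail b' n) ≤ (q + q') * (q + q') :=
      mul_le_mul (by nlinarith) (by nlinarith) (by positivity) (by positivity)
    nlinarith
  have hD := abs_nonneg (cfTail b 0 - cfTail b' 0)
  have h4 := mul_le_mul_of_nonneg_left h3 hD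
  have hK : (0 : ℝ) ≤ ((K : ℝ) + 1) ^ 3 := by positivity
  nlinarith [mul_le_mul_of_nonneg_right h4 hK]

/-- Letters smaller than `K`, with the letter `1` forced at the multiples of `L`. -/
def forcedLetters (K L n : ℕ) : Finset ℕ := if L ∣ n then {1} else Finset.range K

theorem lt_of_mem_admissible {K L : ℕ} (hK : 2 ≤ K) {b : ℕ → ℕ}
    (hb : b ∈ admissible (forcedLetters K L)) (n : ℕ) : b n < K := by
  have := hb n
  unfold forcedLetters at this
  split_ifs at this
  · rw [Finset.mem_singleton] at this
    omega
  · exact Finset.mem_range.1 this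

theorem eq_one_of_mem_admissible {K L : ℕ} {b : ℕ → ℕ}
    (hb : b ∈ admissible (forcedLetters K L)) {n : ℕ} (hn : L ∣ n) : b n = 1 := by
  have := hb n
  rwa [forcedLetters, if_pos hn, Finset.mem_singleton] at this

theorem exists_weights {lam : ℝ} (hlam : 1 < lam) : ∃ L : ℕ, 2 ≤ L ∧ ∃ W : ℕ → ℝ,
    (∀ n, 0 < W n ∧ W n ≤ 6) ∧ (∀ n, L ∣ n → 6 * W n ≤ W (n + 1)) ∧
      ∀ n, ¬ L ∣ n → W n ≤ lam * W (n + 1) := by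
  have h0 : 0 < lam := by linarith
  obtain ⟨l, hl⟩ := pow_unbounded_of_one_lt 6 hlam
  have hinv : lam⁻¹ ≤ 1 := inv_le_one_of_one_le₀ hlam.le
  refine ⟨l + 2, by omega, fun n => if l + 2 ∣ n then 1 else 6 * lam⁻¹ ^ (n % (l + 2) - 1),
    fun n => ?_, fun n hn => ?_, fun n hn => ?_⟩
  · beta_reduce
    split_ifs
    · norm_num
    · have := pow_le_one₀ (n := n % (l + 2) - 1) (inv_nonneg.2 h0.le) hinv
      exact ⟨by positivity, by linarith⟩
  · have h1 : (n + 1) % (l + 2) = 1 := by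
      rw [Nat.add_mod, Nat.mod_eq_zero_of_dvd hn]
      simp
    have h2 : ¬ l + 2 ∣ n + 1 := by
      rw [Nat.dvd_iff_mod_eq_zero, h1]
      omega
    simp [hn, h2, h1]
  · simp only [if_neg hn]
    have hm0 : n % (l + 2) ≠ 0 := fun h => hn (Nat.dvd_of_mod_eq_zero h)
    have hmlt : n % (l + 2) < l + 2 := Nat.mod_lt _ (by omega)
    split_ifs with hd
    · have hm : n % (l + 2) = l + 1 := by
        have h3 := Nat.mod_eq_zero_of_dvd hd
        rw [Nat.add_mod, Nat.mod_eq_of_lt (show 1 < l + 2 by omega)] at h3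
        by_contra hcon
        rw [Nat.mod_eq_of_lt (by omega)] at h3
        omega
      rw [hm, Nat.add_sub_cancel, inv_pow, mul_one]
      have : 6 * (lam ^ l)⁻¹ ≤ 1 := by
        rw [← div_eq_mul_inv, div_le_one (by positivity)]
        exact hl.le
      linarith
    · have hm : (n + 1) % (l + 2) = n % (l + 2) + 1 := by
        rw [Nat.add_mod, Nat.mod_eq_of_lt (show 1 < l + 2 by omega)]
        refine Nat.mod_eq_of_lt ?_
        by_contra hcon
        refine hd (Nat.dvd_of_mod_eq_zero ?_)
        rw [Nat.add_mod, Nat.mod_eq_of_lt (show 1 < l + 2 by omega),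
          show n % (l + 2) + 1 = l + 2 by omega, Nat.mod_self]
      obtain ⟨j, hj⟩ : ∃ j, n % (l + 2) = j + 1 := ⟨n % (l + 2) - 1, by omega⟩
      rw [hm, hj, Nat.add_sub_cancel, Nat.add_sub_cancel, pow_succ]
      apply le_of_eq
      field_simp

theorem exists_letter_bound {s : ℝ} (hs : s < 1) : ∃ K : ℕ, 2 ≤ K ∧
    ∃ lam : ℝ, 1 < lam ∧ ∀ r, 0 ≤ r → r ≤ 1 →
      lam ≤ ∑ a ∈ Finset.range K, branchRatio r a ^ s := by
  set μ : ℝ := 2 ^ (1 - s) with hμ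
  have hμ1 : 1 < μ := Real.one_lt_rpow one_lt_two (by linarith)
  obtain ⟨K, hK⟩ := exists_nat_gt (2 / (μ - 1))
  have hKpos : 0 < μ - 1 := by linarith
  rw [div_lt_iff₀ hKpos] at hK
  refine ⟨K + 2, by omega, μ * (1 - 2 / (K + 4)), ?_, fun r h0 h1 => ?_⟩
  · have : (2 : ℝ) / (K + 4) * (K + 4) = 2 := div_mul_cancel₀ _ (by positivity)
    have hK0 : (0 : ℝ) < (K : ℝ) + 4 := by positivity
    rw [one_sub_div hK0.ne', ← mul_div_assoc, lt_div_iff₀ hK0]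
    linarith
  · have h2 : ∑ a ∈ Finset.range (K + 2), μ * branchRatio r a ≤
        ∑ a ∈ Finset.range (K + 2), branchRatio r a ^ s := by
      refine Finset.sum_le_sum fun a _ => ?_
      have hp := branchRatio_pos h0 a
      have hp2 := branchRatio_le_half h0 a
      have h3 : branchRatio r a ^ s = branchRatio r a ^ (s - 1) * branchRatio r a := by
        rw [← Real.rpow_add_one hp.ne', sub_add_cancel]
      have h4 : μ = (1 / 2 : ℝ) ^ (s - 1) := by
        rw [one_div, Real.inv_rpow (by norm_num), ← Real.rpow_neg (by norm_num), neg_sub]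
      rw [h3, h4]
      exact mul_le_mul_of_nonneg_right
        (Real.rpow_le_rpow_of_nonpos hp hp2 (by linarith)) hp.le
    refine le_trans ?_ h2
    rw [← Finset.mul_sum, sum_branchRatio h0]
    refine mul_le_mul_of_nonneg_left ?_ (by linarith)
    push_cast
    have hK0 : (0 : ℝ) ≤ K := Nat.cast_nonneg K
    have : (1 + r) / ((K : ℝ) + 2 + 1 + r) ≤ 2 / (K + 4) := by
      rw [div_le_div_iff₀ (by positivity) (by positivity)]
      nlinarith
    linarith

theorem branchRatio_one_ge {r : ℝ} (h0 : 0 ≤ r) (h1 : r ≤ 1) : 1 / 6 ≤ branchRatio r 1 := by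
  unfold branchRatio
  push_cast
  rw [div_le_div_iff₀ (by norm_num) (by positivity)]
  nlinarith

theorem exists_large_cantor {s : ℝ} (hs0 : 0 < s) (hs : s < 1) : ∃ K L : ℕ, 2 ≤ K ∧ 2 ≤ L ∧
    Measure.hausdorffMeasure s
      ((fun b => cfTail b 0) '' admissible (forcedLetters K L)) ≠ 0 := by
  obtain ⟨K, hK, lam, hlam, hsum⟩ := exists_letter_bound hs
  obtain ⟨L, hL, W, hW, hW1, hW2⟩ := exists_weights hlam
  refine ⟨K, L, hK, hL, ?_⟩
  have hpow0 : ∀ w, 0 < cylLen w ^ s := fun w => Real.rpow_pos_of_pos (cylLen_pos w) s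
  refine hausdorffMeasure_image_ne_zero (m := fun w => ENNReal.ofReal (cylLen w ^ s * W w.length))
    (C := ENNReal.ofReal (6 * (2 * ((K : ℝ) + 1) ^ 3) ^ s)) (fun n => ?_) ENNReal.ofReal_ne_top hs0
    (fun w => ?_) ?_ (fun b hb b' hb' n heq hne => ?_) (fun b _ ε hε => ?_)
  · unfold forcedLetters
    split_ifs
    · exact Finset.singleton_nonempty _
    · exact ⟨0, Finset.mem_range.2 (by omega)⟩
  · obtain ⟨hr0, hr1⟩ := ratio_bounds w
    have hb := fun a => branchRatio_pos hr0 a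
    rw [← ENNReal.ofReal_sum_of_nonneg fun a _ => mul_nonneg (hpow0 _).le (hW _).1.le]
    refine ENNReal.ofReal_le_ofReal ?_
    have hterm : ∀ a, cylLen (w ++ [a]) ^ s * W (w ++ [a]).length =
        cylLen w ^ s * W (w.length + 1) * branchRatio ((cfDen w).2 / (cfDen w).1) a ^ s := by
      intro a
      rw [cylLen_append, Real.mul_rpow (cylLen_pos w).le (hb a).le, List.length_append,
        List.length_singleton]
      ring
    rw [Finset.sum_congr rfl fun a _ => hterm a, ← Finset.mul_sum, mul_assoc]
    refine mul_le_mul_of_nonneg_left ?_ (hpow0 w).le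
    unfold forcedLetters
    split_ifs with hd
    · rw [Finset.sum_singleton]
      have h6 := branchRatio_one_ge hr0 hr1
      have h7 : branchRatio ((cfDen w).2 / (cfDen w).1) 1 ≤
          branchRatio ((cfDen w).2 / (cfDen w).1) 1 ^ s :=
        Real.self_le_rpow_of_le_one (hb 1).le
          ((branchRatio_le_half hr0 1).trans (by norm_num)) hs.le
      have := hW1 _ hd
      have := (hW (w.length + 1)).1
      nlinarith
    · refine (hW2 _ hd).trans ?_
      rw [mul_comm]
      exact mul_le_mul_of_nonneg_left (hsum _ hr0 hr1) (hW _).1.le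
  · exact (ENNReal.ofReal_pos.2 (mul_pos (hpow0 _) (hW _).1)).ne'
  · have h1 := cylLen_le_abs_sub heq hne (lt_of_mem_admissible hK hb) (lt_of_mem_admissible hK hb')
    rw [edist_dist, Real.dist_eq, ENNReal.ofReal_rpow_of_nonneg (abs_nonneg _) hs0.le,
      ← ENNReal.ofReal_mul (by positivity)]
    refine ENNReal.ofReal_le_ofReal ?_
    have h2 := Real.rpow_le_rpow (cylLen_pos _).le h1 hs0.le
    rw [Real.mul_rpow (by positivity) (abs_nonneg _)] at h2
    have h3 := mul_le_mul h2 (hW (initSeg b n).length).2 (hW _).1.le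
      (le_trans (hpow0 _).le h2)
    refine h3.trans (le_of_eq ?_)
    ring
  · have hlim : Tendsto (fun n : ℕ => ENNReal.ofReal (6 * ((1 / 2 : ℝ) ^ s) ^ n)) atTop (nhds 0) := by
      rw [← ENNReal.ofReal_zero]
      refine ENNReal.tendsto_ofReal ?_
      rw [← mul_zero (6 : ℝ)]
      exact (tendsto_pow_atTop_nhds_zero_of_lt_one (by positivity)
        (Real.rpow_lt_one (by norm_num) (by norm_num) hs0)).const_mul _
    obtain ⟨n, hn⟩ := (hlim.eventually (ge_mem_nhds hε)).exists
    refine ⟨n, le_trans (ENNReal.ofReal_le_ofReal ?_) hn⟩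
    have h1 := cylLen_le (initSeg b n)
    rw [length_initSeg] at h1 ⊢
    have h2 := Real.rpow_le_rpow (cylLen_pos _).le h1 hs0.le
    have h3 : ((1 / 2 : ℝ) ^ n) ^ s = ((1 / 2 : ℝ) ^ s) ^ n := by
      rw [← Real.rpow_natCast, ← Real.rpow_natCast, ← Real.rpow_mul (by norm_num),
        ← Real.rpow_mul (by norm_num), mul_comm]
    rw [h3] at h2
    have h4 := mul_le_mul h2 (hW n).2 (hW n).1.le (by positivity)
    linarith

/-- The inverse branch of the Gauss map for the digit `1`. -/
noncomputable def goldenBranch (x : ℝ) : ℝ := 1 / (1 + x)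

theorem goldenBranch_mem {x : ℝ} (h0 : 0 < x) (h1 : x < 1) :
    1 / 2 < goldenBranch x ∧ goldenBranch x < 1 := by
  unfold goldenBranch
  constructor
  · exact one_div_lt_one_div_of_lt (by linarith) (by linarith)
  · rw [div_lt_one (by linarith)]
    linarith

theorem iterate_goldenBranch_mem {x : ℝ} (h0 : 0 < x) (h1 : x < 1) (m : ℕ) :
    0 < goldenBranch^[m] x ∧ goldenBranch^[m] x < 1 := by
  induction m with
  | zero => exact ⟨h0, h1⟩
  | succ m ih =>
    rw [Function.iterate_succ_apply']
    have := goldenBranch_mem ih.1 ih.2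
    exact ⟨by linarith [this.1], this.2⟩

theorem gauss_goldenBranch {x : ℝ} (h0 : 0 < x) (h1 : x < 1) : gauss (goldenBranch x) = x := by
  refine gauss_eq 1 ?_ h0.le h1
  unfold goldenBranch
  rw [one_div_one_div]
  norm_num

theorem abs_goldenBranch_sub_g_le {x : ℝ} (h0 : 0 < x) :
    |goldenBranch x - g| ≤ g * |x - g| := by
  have hg := g_gt
  unfold goldenBranch
  rw [inv_one_add_sub_g h0.le, abs_mul, abs_sub_comm, mul_comm]
  refine mul_le_mul_of_nonneg_right ?_ (abs_nonneg _)
  rw [abs_of_nonneg (div_nonneg (by linarith) (by linarith))]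
  exact div_le_self (by linarith) (by linarith)

theorem abs_iterate_goldenBranch_sub_g_le {x : ℝ} (h0 : 0 < x) (h1 : x < 1) (m : ℕ) :
    |goldenBranch^[m] x - g| ≤ g ^ m * |x - g| := by
  induction m with
  | zero => simp
  | succ m ih =>
    rw [Function.iterate_succ_apply', pow_succ', mul_assoc]
    refine (abs_goldenBranch_sub_g_le (iterate_goldenBranch_mem h0 h1 m).1).trans ?_
    exact mul_le_mul_of_nonneg_left ih (by linarith [g_gt])

theorem g_lt_goldenBranch {x : ℝ} (h0 : 0 < x) (h1 : x < g) : g < goldenBranch x := by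
  have hg := g_gt
  have := inv_one_add_sub_g h0.le
  have : 0 < (g - x) * (g / (1 + x)) :=
    mul_pos (by linarith) (div_pos (by linarith) (by linarith))
  unfold goldenBranch
  linarith

theorem goldenBranch_lt_g {x : ℝ} (h1 : g < x) : goldenBranch x < g := by
  have hg := g_gt
  have := inv_one_add_sub_g (y := x) (by linarith)
  have : 0 < (x - g) * (g / (1 + x)) :=
    mul_pos (by linarith) (div_pos (by linarith) (by linarith))
  unfold goldenBranch
  linarith

theorem g_lt_iterate_goldenBranch {x : ℝ} (h0 : 0 < x) (h1 : x < g) (i : ℕ) :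
    g < goldenBranch^[2 * i + 1] x := by
  induction i with
  | zero => exact g_lt_goldenBranch h0 h1
  | succ i ih =>
    have h2 := iterate_goldenBranch_mem h0 (by linarith [g_lt]) (2 * i + 2)
    rw [show 2 * (i + 1) + 1 = 2 * i + 1 + 1 + 1 by ring, Function.iterate_succ_apply']
    refine g_lt_goldenBranch h2.1 ?_
    rw [Function.iterate_succ_apply']
    exact goldenBranch_lt_g ih

theorem not_hole_of_far {α z : ℝ} (hα : g < α) (h1 : α - g ≤ |z - g|)
    (h2 : α - g ≤ |z - (1 - g)|) : ¬ Hole α z := by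
  have hg := g_gt
  have hinv : g - (α - g) < 1 / (1 + α) := by
    rw [lt_div_iff₀ (by linarith)]
    nlinarith [g_sq]
  rintro (⟨h3, h4⟩ | ⟨h3, h4⟩)
  · rw [div_one_add_eq (by linarith)] at h4
    refine absurd h2 (not_le.2 (abs_lt.2 ⟨?_, ?_⟩)) <;> linarith
  · refine absurd h1 (not_le.2 (abs_lt.2 ⟨?_, ?_⟩)) <;> linarith

theorem gauss_cfTail (b : ℕ → ℕ) (k : ℕ) : gauss (cfTail b k) = cfTail b (k + 1) := by
  refine gauss_eq (b k + 1) ?_ (cfTail_nonneg b _) (cfTail_lt_one b _)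
  rw [cfTail_eq b k, one_div_one_div]
  push_cast
  ring

theorem iterate_gauss_cfTail (b : ℕ → ℕ) (k : ℕ) : gauss^[k] (cfTail b 0) = cfTail b k := by
  induction k with
  | zero => rfl
  | succ k ih => rw [Function.iterate_succ_apply', ih, gauss_cfTail]

theorem iterate_gauss_iterate_goldenBranch {x : ℝ} (h0 : 0 < x) (h1 : x < 1) (i j : ℕ) :
    gauss^[i] (goldenBranch^[i + j] x) = goldenBranch^[j] x := by
  induction i with
  | zero => rw [zero_add]; rfl
  | succ i ih =>
    have := iterate_goldenBranch_mem h0 h1 (i + j)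
    rw [Function.iterate_succ_apply, show i + 1 + j = i + j + 1 by ring,
      Function.iterate_succ_apply' goldenBranch, gauss_goldenBranch this.1 this.2, ih]

theorem cfTail_lt_half {b : ℕ → ℕ} {k : ℕ} (h : 1 ≤ b k) : cfTail b k < 1 / 2 := by
  have h1 := cfTail_pos b (k + 1)
  have h2 : (1 : ℝ) ≤ b k := by exact_mod_cast h
  rw [cfTail_eq]
  exact one_div_lt_one_div_of_lt (by norm_num) (by linarith)

theorem cfTail_far_from_g_step (b : ℕ → ℕ) (k : ℕ) :
    |cfTail b (k + 1) - g| / 8 ≤ |cfTail b k - g| := by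
  have hg := g_gt
  have hg' := g_lt
  have h1 := cfTail_pos b (k + 1)
  have h2 := cfTail_lt_one b (k + 1)
  rcases Nat.eq_zero_or_pos (b k) with h | h
  · rw [cfTail_eq b k, h, Nat.cast_zero, zero_add, inv_one_add_sub_g h1.le, abs_mul,
      abs_sub_comm, div_eq_mul_one_div]
    refine mul_le_mul_of_nonneg_left ?_ (abs_nonneg _)
    refine le_trans ?_ (le_abs_self _)
    rw [div_le_div_iff₀ (by norm_num) (by linarith)]
    linarith
  · have h3 := cfTail_lt_half h
    have h4 : |cfTail b (k + 1) - g| ≤ 0.62 := abs_le.2 ⟨by linarith, by linarith⟩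
    have h5 := neg_abs_le (cfTail b k - g)
    linarith

theorem cfTail_far_from_g {b : ℕ → ℕ} (i : ℕ) : ∀ k, b (k + i) = 1 →
    (1 / 8) ^ i / 10 ≤ |cfTail b k - g| := by
  induction i with
  | zero =>
    intro k hk
    have h3 := cfTail_lt_half (b := b) (k := k) (by rw [add_zero] at hk; omega)
    have h5 := neg_abs_le (cfTail b k - g)
    have := g_gt
    rw [pow_zero]
    linarith
  | succ i ih =>
    intro k hk
    have h1 := ih (k + 1) (by rw [← hk]; congr 1; omega)
    have h2 := cfTail_far_from_g_step b k
    rw [pow_succ]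
    linarith

theorem cfTail_far {K L : ℕ} (hL : 0 < L) {b : ℕ → ℕ} (hb : b ∈ admissible (forcedLetters K L))
    (k : ℕ) : (1 / 8) ^ L / 10 ≤ |cfTail b k - g| := by
  obtain ⟨i, hi, hd⟩ : ∃ i < L, L ∣ k + i := by
    rcases Nat.eq_zero_or_pos (k % L) with h | h
    · exact ⟨0, hL, Nat.dvd_of_mod_eq_zero h⟩
    · refine ⟨L - k % L, by omega, ⟨k / L + 1, ?_⟩⟩
      have h1 := Nat.div_add_mod k L
      have h2 := Nat.mod_lt k hL
      rw [mul_add, mul_one]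
      omega
  refine le_trans ?_ (cfTail_far_from_g i k (eq_one_of_mem_admissible hb hd))
  have : (1 / 8 : ℝ) ^ L ≤ (1 / 8) ^ i := pow_le_pow_of_le_one (by norm_num) (by norm_num) hi.le
  linarith

theorem one_div_two_add_sub {x : ℝ} (h : 0 < x) :
    1 / (2 + x) - (1 - g) = (g - x) * ((1 - g) / (2 + x)) := by
  have := g_sq
  field_simp
  linarith

theorem cfTail_far' {K L : ℕ} (hL : 0 < L) {b : ℕ → ℕ} (hb : b ∈ admissible (forcedLetters K L))
    (k : ℕ) : (1 / 8) ^ L / 100 ≤ |cfTail b k - (1 - g)| := by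
  have hg := g_gt
  have hg' := g_lt
  have hpow : (1 / 8 : ℝ) ^ L ≤ 1 := pow_le_one₀ (by norm_num) (by norm_num)
  have h1 := cfTail_pos b (k + 1)
  have h2 := cfTail_lt_one b (k + 1)
  rcases lt_trichotomy (b k) 1 with h | h | h
  · have h0 : b k = 0 := by omega
    have h3 : 1 / 2 ≤ cfTail b k := by
      rw [cfTail_eq, h0, Nat.cast_zero]
      exact one_div_le_one_div_of_le (by linarith) (by linarith)
    have := le_abs_self (cfTail b k - (1 - g))
    linarith
  · have h3 := cfTail_far hL hb (k + 1)
    rw [cfTail_eq b k, h, Nat.cast_one, one_add_one_eq_two, one_div_two_add_sub h1, abs_mul,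
      abs_sub_comm]
    have h4 : 1 / 9 ≤ |(1 - g) / (2 + cfTail b (k + 1))| := by
      refine le_trans ?_ (le_abs_self _)
      rw [div_le_div_iff₀ (by norm_num) (by linarith)]
      linarith
    have h5 : (0 : ℝ) < (1 / 8) ^ L := by positivity
    nlinarith
  · have h3 : cfTail b k ≤ 1 / 3 := by
      have h4 : (2 : ℝ) ≤ b k := by exact_mod_cast h
      rw [cfTail_eq]
      exact one_div_le_one_div_of_le (by norm_num) (by linarith)
    have := neg_abs_le (cfTail b k - (1 - g))
    linarith

/-- The parameter whose critical orbit shadows the golden mean `m` times and then follows `x`. -/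
noncomputable def shadowParam (m : ℕ) (x : ℝ) : ℝ := 1 - 1 / (2 + goldenBranch^[m] x)

theorem shadowParam_mem {K L : ℕ} (hL : 0 < L) {b : ℕ → ℕ}
    (hb : b ∈ admissible (forcedLetters K L)) {δ : ℝ} {i : ℕ} (hδ : g ^ (2 * i + 1) < δ)
    (hi : g ^ (2 * i + 1) ≤ (1 / 8) ^ L / 100)
    (ht : Transcendental ℤ (shadowParam (2 * i + 1) (cfTail b 0))) :
    shadowParam (2 * i + 1) (cfTail b 0) ∈ E ∩ Ioo g (g + δ) := by
  have hg := g_gt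
  have hg' := g_lt
  have hx0 := cfTail_pos b 0
  have hx1 := cfTail_lt_half (eq_one_of_mem_admissible hb (dvd_zero L)).ge
  have hm := iterate_goldenBranch_mem hx0 (by linarith)
  have hgt := g_lt_iterate_goldenBranch hx0 (by linarith) i
  have habs := abs_iterate_goldenBranch_sub_g_le hx0 (by linarith) (2 * i + 1)
  set m := 2 * i + 1 with hm_def
  set α := shadowParam m (cfTail b 0) with hα
  set u := goldenBranch^[m] (cfTail b 0) with hu
  obtain ⟨hu0, hu1⟩ := hm m
  have hsub : α - g = (u - g) * ((1 - g) / (2 + u)) := by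
    have := one_div_two_add_sub hu0
    rw [hα, shadowParam, ← hu]
    linarith
  have hfac0 : 0 < (1 - g) / (2 + u) := div_pos (by linarith) (by linarith)
  have hfac1 : (1 - g) / (2 + u) ≤ 1 := by
    rw [div_le_one (by linarith)]
    linarith
  have hαg : g < α := by nlinarith
  have hαu : α - g ≤ |u - g| := by
    rw [hsub, abs_of_pos (by linarith)]
    exact mul_le_of_le_one_right (by linarith) hfac1
  have hpow : 0 < g ^ m := by positivity
  have hαm : α - g ≤ g ^ m := by
    have : |cfTail b 0 - g| ≤ 1 := abs_le.2 ⟨by linarith, by linarith⟩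
    nlinarith
  have hL1 : (1 / 8 : ℝ) ^ L ≤ 1 := pow_le_one₀ (by norm_num) (by norm_num)
  have hα1 : α < 1 := by linarith
  refine ⟨⟨⟨by linarith, hα1.le⟩, not_mem_matchingSet ht hαg hα1 fun k hk => ?_⟩, hαg, by linarith⟩
  have hstart : gauss (1 - α) = u := by
    refine gauss_eq 2 ?_ hu0.le hu1
    rw [hα, shadowParam, ← hu, sub_sub_cancel, one_div_one_div]
    norm_num
  obtain ⟨k, rfl⟩ : ∃ l, k = l + 1 := ⟨k - 1, by omega⟩
  rw [Function.iterate_succ_apply, hstart]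
  have htail : ∀ l, ¬ Hole α (cfTail b l) := fun l => by
    have h1 := cfTail_far hL hb l
    have h2 := cfTail_far' hL hb l
    have h3 : (0 : ℝ) < (1 / 8) ^ L := by positivity
    exact not_hole_of_far hαg (by linarith) (by linarith)
  rcases lt_or_ge k m with hkm | hkm
  · obtain ⟨j, hj⟩ : ∃ j, m = k + (j + 1) := ⟨m - k - 1, by omega⟩
    have hz : gauss^[k] u = goldenBranch^[j + 1] (cfTail b 0) := by
      rw [hu, hj]
      exact iterate_gauss_iterate_goldenBranch hx0 (by linarith) k (j + 1)
    rw [hz]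
    refine not_hole_of_far hαg (hαu.trans ?_) ?_
    · have h1 := hm (j + 1)
      have h2 := abs_iterate_goldenBranch_sub_g_le h1.1 h1.2 k
      rw [← Function.iterate_add_apply, ← hj] at h2
      exact h2.trans (mul_le_of_le_one_left (abs_nonneg _)
        (pow_le_one₀ (by linarith) (by linarith)))
    · have h1 := hm j
      have h2 := goldenBranch_mem h1.1 h1.2
      rw [← Function.iterate_succ_apply' goldenBranch] at h2
      have := le_abs_self (goldenBranch^[j + 1] (cfTail b 0) - (1 - g))
      linarith [h2.1]
  · obtain ⟨j, rfl⟩ : ∃ j, k = j + m := ⟨k - m, by omega⟩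
    have hz := iterate_gauss_iterate_goldenBranch hx0 (by linarith) m 0
    rw [add_zero, Function.iterate_zero, id, ← hu] at hz
    rw [Function.iterate_add_apply, hz, iterate_gauss_cfTail]
    exact htail j

theorem dimH_le_dimH_inv_image {a : ℝ} (ha : 1 ≤ a) {A : Set ℝ} (hA : A ⊆ Icc 0 1) :
    dimH A ≤ dimH ((fun x => 1 / (a + x)) '' A) := by
  have hlip : LipschitzOnWith ((a + 1) ^ 2).toNNReal (fun y => 1 / y - a)
      ((fun x => 1 / (a + x)) '' A) := by
    refine LipschitzOnWith.of_dist_le_mul ?_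
    rintro _ ⟨x, hx, rfl⟩ _ ⟨y, hy, rfl⟩
    obtain ⟨hx0, hx1⟩ := hA hx
    obtain ⟨hy0, hy1⟩ := hA hy
    rw [Real.coe_toNNReal _ (by positivity), Real.dist_eq, Real.dist_eq, one_div_one_div,
      one_div_one_div, div_sub_div _ _ (by positivity) (by positivity), abs_div,
      abs_of_pos (show 0 < (a + x) * (a + y) by positivity), ← mul_div_assoc,
      le_div_iff₀ (by positivity)]
    have h1 : |a + x - a - (a + y - a)| = |1 * (a + y) - (a + x) * 1| := by
      rw [abs_sub_comm]
      congr 1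
      ring
    rw [h1, mul_comm, sq]
    exact mul_le_mul_of_nonneg_right
      (mul_le_mul (by linarith) (by linarith) (by linarith) (by linarith)) (abs_nonneg _)
  have himg : (fun y => 1 / y - a) '' ((fun x => 1 / (a + x)) '' A) = A := by
    rw [image_image]
    simp
  calc dimH A = dimH ((fun y => 1 / y - a) '' ((fun x => 1 / (a + x)) '' A)) := by rw [himg]
    _ ≤ _ := hlip.dimH_image_le

theorem dimH_le_dimH_iterate_goldenBranch (m : ℕ) {A : Set ℝ} (hA : A ⊆ Ioo 0 1) :
    dimH A ≤ dimH (goldenBranch^[m] '' A) := by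
  induction m with
  | zero => simp
  | succ m ih =>
    rw [Function.iterate_succ', image_comp]
    refine ih.trans (dimH_le_dimH_inv_image le_rfl ?_)
    rintro _ ⟨x, hx, rfl⟩
    have := iterate_goldenBranch_mem (hA hx).1 (hA hx).2 m
    exact ⟨this.1.le, this.2.le⟩

theorem dimH_le_dimH_shadowParam (m : ℕ) {A : Set ℝ} (hA : A ⊆ Ioo 0 1) :
    dimH A ≤ dimH (shadowParam m '' A) := by
  have himg : shadowParam m '' A = IsometryEquiv.subLeft (1 : ℝ) ''
      ((fun x => 1 / (2 + x)) '' (goldenBranch^[m] '' A)) := by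
    rw [image_image, image_image]
    rfl
  rw [himg, IsometryEquiv.dimH_image]
  refine (dimH_le_dimH_iterate_goldenBranch m hA).trans
    (dimH_le_dimH_inv_image one_le_two ?_)
  rintro _ ⟨x, hx, rfl⟩
  have := iterate_goldenBranch_mem (hA hx).1 (hA hx).2 m
  exact ⟨this.1.le, this.2.le⟩

theorem dimH_bifurcation_near_g {δ : ℝ} (hδ : 0 < δ) : dimH (E ∩ Ioo g (g + δ)) = 1 := by
  have hg := g_gt
  refine le_antisymm ((dimH_mono (subset_univ _)).trans_eq Real.dimH_univ) ?_
  by_contra! hlt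
  obtain ⟨s, hs1, hs2⟩ := ENNReal.lt_iff_exists_nnreal_btwn.1 hlt
  have hs0 : (0 : ℝ) < s := by exact_mod_cast zero_le.trans_lt hs1
  obtain ⟨K, L, -, hL, hne⟩ := exists_large_cantor hs0 (by exact_mod_cast hs2)
  set A := (fun b => cfTail b 0) '' admissible (forcedLetters K L) with hA
  have hA01 : A ⊆ Ioo 0 1 := by
    rintro _ ⟨b, -, rfl⟩
    exact ⟨cfTail_pos b 0, cfTail_lt_one b 0⟩
  obtain ⟨i, hi⟩ := exists_pow_g_lt (lt_min hδ (show (0 : ℝ) < (1 / 8) ^ L / 100 by positivity))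
  have hi' : g ^ (2 * i + 1) < min δ ((1 / 8) ^ L / 100) :=
    (pow_le_pow_of_le_one (by linarith) (by linarith [g_lt]) (by omega)).trans_lt hi
  have hsub : shadowParam (2 * i + 1) '' A ⊆ {x : ℝ | IsAlgebraic ℤ x} ∪ (E ∩ Ioo g (g + δ)) := by
    rintro _ ⟨_, ⟨b, hb, rfl⟩, rfl⟩
    by_cases ht : IsAlgebraic ℤ (shadowParam (2 * i + 1) (cfTail b 0))
    · exact Or.inl ht
    · exact Or.inr (shadowParam_mem (by omega) hb (lt_min_iff.1 hi').1 (lt_min_iff.1 hi').2.le ht)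
  have h1 := (le_dimH_of_hausdorffMeasure_ne_zero hne).trans
    ((dimH_le_dimH_shadowParam (2 * i + 1) hA01).trans (dimH_mono hsub))
  rw [dimH_union, dimH_algebraic, max_eq_right zero_le] at h1
  exact absurd hs1 (not_lt.2 h1)

theorem stmt11 (δ : ℝ) (hδ : 0 < δ) :
    dimH (E ∩ Set.Ioo g (g + δ)) = 1 ∧ dimH (E ∩ Set.Ioo (g + δ) 1) < 1 :=
  ⟨dimH_bifurcation_near_g hδ, dimH_bifurcation_lt_one hδ⟩
end

section
/- The set 𝓔 ∩ ℚ of rational bifurcation parameters is infinite, and it has no isolated points: every rational number in 𝓔 is an accumulation point of 𝓔 ∩ ℚ. -/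
open Set Filter MeasureTheory
open scoped ENNReal

open scoped Topology

/-- The `n`-th iterate under `T α` of the shifted parameter `α - e`. -/
noncomputable def orb (e : ℤ) (n : ℕ) (α : ℝ) : ℝ := (T α)^[n] (α - e)

lemma orb_zero (e : ℤ) (α : ℝ) : orb e 0 α = α - e := rfl

lemma orb_succ (e : ℤ) (n : ℕ) (α : ℝ) : orb e (n + 1) α = T α (orb e n α) :=
  Function.iterate_succ_apply' _ _ _

lemma T_zero (α : ℝ) : T α 0 = 0 := by simp [T]

lemma exists_T_eq (α : ℝ) {x : ℝ} (hx : x ≠ 0) : ∃ k : ℤ, T α x = 1 / x - k :=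
  ⟨_, if_neg hx⟩

lemma T_mem_Ico (α : ℝ) {x : ℝ} (hx : x ≠ 0) : T α x ∈ Ico (α - 1) α := by
  rw [T, if_neg hx]
  have h1 := Int.floor_le (1 / x + 1 - α)
  have h2 := Int.lt_floor_add_one (1 / x + 1 - α)
  constructor <;> linarith

lemma T_eq_of_mem {α x : ℝ} {k : ℤ} (hx : x ≠ 0) (h : 1 / x - k ∈ Ico (α - 1) α) :
    T α x = 1 / x - k := by
  have : ⌊1 / x + 1 - α⌋ = k := by
    rw [Int.floor_eq_iff]
    constructor <;> linarith [h.1, h.2]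
  rw [T, if_neg hx, this]

lemma T_eq_T_of_sub {α x y : ℝ} {c : ℤ} (h : x - y = c * x * y) : T α x = T α y := by
  rcases eq_or_ne x 0 with rfl | hx
  · have : y = 0 := by simpa using h
    rw [this]
  have hy : y ≠ 0 := by
    rintro rfl
    simp at h
    exact hx h
  obtain ⟨k, hk⟩ := exists_T_eq α hx
  have hxy : 1 / x - k = 1 / y - ((c + k : ℤ) : ℝ) := by
    push_cast
    field_simp
    linear_combination -h
  have := T_mem_Ico α hx
  rw [hk, hxy] at this
  rw [hk, hxy, T_eq_of_mem hy this]

/-- The convention at the endpoints aside, `T` is invariant under `(α, x) ↦ (1 - α, -x)`. -/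
lemma T_one_sub_neg {α x : ℝ} (h : T α x ≠ α - 1) : T (1 - α) (-x) = -T α x := by
  rcases eq_or_ne x 0 with rfl | hx
  · simp [T]
  obtain ⟨k, hk⟩ := exists_T_eq α hx
  have hm := T_mem_Ico α hx
  have hlt := lt_of_le_of_ne hm.1 h.symm
  rw [hk] at hlt hm ⊢
  have h1 : 1 / (-x) = -(1 / x) := by rw [div_neg]
  rw [T_eq_of_mem (k := -k) (neg_ne_zero.2 hx)]
  · push_cast
    rw [h1]
    ring
  · rw [h1]
    push_cast
    constructor <;> linarith [hm.2]

section Rational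

variable {q : ℚ} {e : ℤ} {n : ℕ}

lemma abs_orb_lt_one (h0 : 0 < q) (h1 : q < 1) (he : e = 0 ∨ e = 1) (n : ℕ) :
    |orb e n q| < 1 := by
  have h0' : (0 : ℝ) < q := by exact_mod_cast h0
  have h1' : (q : ℝ) < 1 := by exact_mod_cast h1
  rw [abs_lt]
  cases n with
  | zero => rcases he with rfl | rfl <;> simp only [orb_zero] <;> push_cast <;>
      constructor <;> linarith
  | succ n =>
    rw [orb_succ]
    rcases eq_or_ne (orb e n q) 0 with h | h
    · simp [h, T_zero]
    · have := T_mem_Ico q h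
      constructor <;> linarith [this.1, this.2]

lemma orb_eq_div (h0 : 0 < q) (h1 : q < 1) (he : e = 0 ∨ e = 1) (n : ℕ) :
    orb e n q = 0 ∨ ∃ u v : ℤ, 0 < v ∧ v + n ≤ q.den ∧ orb e n q = u / v := by
  induction n with
  | zero =>
    refine Or.inr ⟨q.num - e * q.den, q.den, by exact_mod_cast q.den_pos, by simp, ?_⟩
    have hd : (q.den : ℝ) ≠ 0 := by exact_mod_cast q.den_ne_zero
    have hq : (q : ℝ) = q.num / q.den := by exact_mod_cast (Rat.num_div_den q).symm
    rw [orb_zero, hq]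
    push_cast
    field_simp
  | succ n ih =>
    rw [orb_succ]
    by_cases hx : orb e n q = 0
    · left
      rw [hx, T_zero]
    obtain ⟨u, v, hv, hvn, huv⟩ := ih.resolve_left hx
    right
    have habs := abs_orb_lt_one h0 h1 he n
    have hv' : (0 : ℝ) < v := by exact_mod_cast hv
    have huv' : |u| < v := by
      rw [huv, abs_div, abs_of_pos hv', div_lt_one hv'] at habs
      exact_mod_cast habs
    have hu : u ≠ 0 := by
      rintro rfl
      simp [huv] at hx
    have hu' : (u : ℝ) ≠ 0 := by exact_mod_cast hu
    obtain ⟨k, hk⟩ := exists_T_eq q hx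
    rcases lt_or_gt_of_ne hu with hneg | hpos
    · refine ⟨k * u - v, -u, by lia, ?_, ?_⟩
      · rw [abs_of_neg hneg] at huv'
        push_cast
        lia
      · rw [hk, huv]
        push_cast
        field_simp
        ring
    · refine ⟨v - k * u, u, by lia, ?_, ?_⟩
      · rw [abs_of_pos hpos] at huv'
        push_cast
        lia
      · rw [hk, huv]
        push_cast
        field_simp

lemma orb_den_eq_zero (h0 : 0 < q) (h1 : q < 1) (he : e = 0 ∨ e = 1) : orb e q.den q = 0 := by
  rcases orb_eq_div h0 h1 he q.den with h | ⟨u, v, hv, hvn, -⟩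
  · exact h
  · lia

lemma orb_succ_ne_sub_one (h0 : 0 < q) (h1 : q < 1) (he : e = 0 ∨ e = 1) (n : ℕ) :
    orb e (n + 1) q ≠ q - 1 := by
  intro hq
  rcases orb_eq_div h0 h1 he (n + 1) with h | ⟨u, v, hv, hvn, huv⟩
  · have h1' : (q : ℝ) < 1 := by exact_mod_cast h1
    linarith
  · have hv' : (v : ℝ) ≠ 0 := by exact_mod_cast hv.ne'
    have hqr : (q : ℝ) = (((u + v : ℤ) : ℝ) / v) := by
      push_cast
      rw [add_div, div_self hv']
      linarith
    have hqq : q = ((u + v : ℤ) : ℚ) / (v : ℚ) := by exact_mod_cast hqr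
    have hd := Rat.den_dvd (u + v) v
    rw [Rat.divInt_eq_div, ← hqq] at hd
    have := Int.le_of_dvd hv hd
    push_cast at hvn
    lia

lemma orb_succ_mem_Ioo (h0 : 0 < q) (h1 : q < 1) (he : e = 0 ∨ e = 1) (n : ℕ) :
    orb e (n + 1) q ∈ Ioo ((q : ℝ) - 1) q := by
  have h0' : (0 : ℝ) < q := by exact_mod_cast h0
  have h1' : (q : ℝ) < 1 := by exact_mod_cast h1
  have hne := orb_succ_ne_sub_one h0 h1 he n
  rw [orb_succ] at hne ⊢
  rcases eq_or_ne (orb e n q) 0 with h | h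
  · rw [h, T_zero]
    constructor <;> linarith
  · have := T_mem_Ico q h
    exact ⟨lt_of_le_of_ne this.1 hne.symm, this.2⟩

end Rational

lemma eventually_T_eq {α₀ : ℝ} {f : ℝ → ℝ} {k : ℤ} (hf : ContinuousAt f α₀) (h0 : f α₀ ≠ 0)
    (hT : 1 / f α₀ - k ∈ Ioo (α₀ - 1) α₀) :
    ∀ᶠ α in 𝓝 α₀, T α (f α) = 1 / f α - k := by
  have hg : ContinuousAt (fun α => 1 / f α - k) α₀ :=
    (continuousAt_const.div hf h0).sub continuousAt_const
  have h1 := (continuousAt_id.sub (continuousAt_const (y := (1 : ℝ)))).eventually_lt hg hT.1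
  have h2 := hg.eventually_lt continuousAt_id hT.2
  filter_upwards [h1, h2, hf.eventually_ne h0] with α h1 h2 h3
  exact T_eq_of_mem h3 ⟨h1.le, h2⟩

/-- The orbit of `α - e` does not vanish before time `n`. -/
def OrbNeZero (e : ℤ) (n : ℕ) (α : ℝ) : Prop := ∀ i < n, orb e i α ≠ 0

lemma OrbNeZero.succ {e : ℤ} {n : ℕ} {α : ℝ} (h : OrbNeZero e n α) (hn : orb e n α ≠ 0) :
    OrbNeZero e (n + 1) α := by
  intro i hi
  rcases Nat.lt_succ_iff_lt_or_eq.1 hi with h' | rfl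
  exacts [h i h', hn]

lemma OrbNeZero.mono {e : ℤ} {m n : ℕ} {α : ℝ} (h : OrbNeZero e n α) (hmn : m ≤ n) :
    OrbNeZero e m α := fun i hi => h i (hi.trans_le hmn)

section Germs

variable {q : ℚ} {e : ℤ} {n m : ℕ}

lemma exists_eventually_orb_succ_eq (h0 : 0 < q) (h1 : q < 1) (he : e = 0 ∨ e = 1)
    (hc : ContinuousAt (orb e n) q) (hn : orb e n q ≠ 0) :
    ∃ k : ℤ, ∀ᶠ α in 𝓝 (q : ℝ), orb e (n + 1) α = 1 / orb e n α - k := by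
  have hm := orb_succ_mem_Ioo h0 h1 he n
  rw [orb_succ] at hm
  obtain ⟨k, hk⟩ := exists_T_eq q hn
  rw [hk] at hm
  refine ⟨k, ?_⟩
  simp_rw [orb_succ]
  exact eventually_T_eq hc hn hm

/-- Before it hits zero, the orbit of a rational parameter is locally a Möbius function of the
parameter. -/
lemma exists_eventually_orb_eq_mobius (h0 : 0 < q) (h1 : q < 1) (he : e = 0 ∨ e = 1)
    (hn : OrbNeZero e n q) :
    ∃ a b c d : ℚ, a * d - b * c ≠ 0 ∧ c * q + d ≠ 0 ∧
      ∀ᶠ α in 𝓝 (q : ℝ), orb e n α = (a * α + b) / (c * α + d) := by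
  induction n with
  | zero => exact ⟨1, -e, 0, 1, by simp, by simp, by simp [orb_zero, sub_eq_add_neg]⟩
  | succ n ih =>
    obtain ⟨a, b, c, d, hdet, hden, hev⟩ := ih (hn.mono n.le_succ)
    have hden' : (c * q + d : ℝ) ≠ 0 := by exact_mod_cast hden
    have hc : ContinuousAt (orb e n) q := by
      refine ContinuousAt.congr ?_ (EventuallyEq.symm hev)
      fun_prop (disch := exact hden')
    have hnz := hn n n.lt_succ_self
    obtain ⟨k, hk⟩ := exists_eventually_orb_succ_eq h0 h1 he hc hnz
    have hnum : (a * q + b : ℝ) ≠ 0 := by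
      rw [hev.self_of_nhds] at hnz
      exact (div_ne_zero_iff.1 hnz).1
    have hnum_ev : ∀ᶠ α : ℝ in 𝓝 (q : ℝ), (a * α + b : ℝ) ≠ 0 :=
      ContinuousAt.eventually_ne (by fun_prop) hnum
    refine ⟨c - k * a, d - k * b, a, b, ?_, by exact_mod_cast hnum, ?_⟩
    · intro h
      apply hdet
      linear_combination -h
    · filter_upwards [hev, hk, hnum_ev] with α h1 h2 h3
      rw [h2, h1, one_div_div]
      push_cast
      rw [eq_div_iff h3, sub_mul, div_mul_cancel₀ _ h3]
      ring

lemma continuousAt_orb (h0 : 0 < q) (h1 : q < 1) (he : e = 0 ∨ e = 1)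
    (hn : OrbNeZero e n q) : ContinuousAt (orb e n) q := by
  obtain ⟨a, b, c, d, -, hden, hev⟩ := exists_eventually_orb_eq_mobius h0 h1 he hn
  have hden' : (c * q + d : ℝ) ≠ 0 := by exact_mod_cast hden
  refine ContinuousAt.congr ?_ (EventuallyEq.symm hev)
  fun_prop (disch := exact hden')

lemma eventually_orbNeZero (h0 : 0 < q) (h1 : q < 1) (he : e = 0 ∨ e = 1)
    (hn : OrbNeZero e n q) : ∀ᶠ α in 𝓝 (q : ℝ), OrbNeZero e n α := by
  have : ∀ᶠ α in 𝓝 (q : ℝ), ∀ i ∈ Finset.range n, orb e i α ≠ 0 := by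
    rw [Filter.eventually_all_finset]
    intro i hi
    rw [Finset.mem_range] at hi
    exact (continuousAt_orb h0 h1 he (hn.mono hi.le)).eventually_ne (hn i hi)
  filter_upwards [this] with α h i hi
  exact h i (Finset.mem_range.2 hi)

lemma eventually_orb_ne_zero (h0 : 0 < q) (h1 : q < 1) (he : e = 0 ∨ e = 1)
    (hn : OrbNeZero e n q) : ∀ᶠ α in 𝓝[≠] (q : ℝ), orb e n α ≠ 0 := by
  obtain ⟨a, b, c, d, hdet, hden, hev⟩ := exists_eventually_orb_eq_mobius h0 h1 he hn
  have hden' : (c * q + d : ℝ) ≠ 0 := by exact_mod_cast hden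
  have hdet' : (a * d - b * c : ℝ) ≠ 0 := by exact_mod_cast hdet
  have hden_ev : ∀ᶠ α : ℝ in 𝓝 (q : ℝ), (c * α + d : ℝ) ≠ 0 :=
    ContinuousAt.eventually_ne (by fun_prop) hden'
  by_cases hz : (a * q + b : ℝ) = 0
  · filter_upwards [nhdsWithin_le_nhds hev, nhdsWithin_le_nhds hden_ev, self_mem_nhdsWithin]
      with α h1 h2 h3
    rw [h1]
    refine div_ne_zero (fun h => ?_) h2
    have ha : (a : ℝ) * (α - q) = 0 := by linear_combination h - hz
    rcases mul_eq_zero.1 ha with ha | ha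
    · apply hdet'
      have hb : (b : ℝ) = 0 := by simpa [ha] using hz
      simp [ha, hb]
    · exact h3 (sub_eq_zero.1 ha)
  · have hz_ev : ∀ᶠ α : ℝ in 𝓝 (q : ℝ), (a * α + b : ℝ) ≠ 0 :=
      ContinuousAt.eventually_ne (by fun_prop) hz
    filter_upwards [nhdsWithin_le_nhds hev, nhdsWithin_le_nhds hden_ev,
      nhdsWithin_le_nhds hz_ev] with α h1 h2 h3
    rw [h1]
    exact div_ne_zero h3 h2

/-- There are rational parameters arbitrarily close to a zero of the orbit at which the orbit takes
the value `1 / k` for some positive integer `k`. -/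
lemma frequently_orb_eq_one_div (h0 : 0 < q) (h1 : q < 1) (he : e = 0 ∨ e = 1)
    (hn : OrbNeZero e n q) (hz : orb e n q = 0) :
    ∃ᶠ r : ℝ in 𝓝 (q : ℝ), (∃ q' : ℚ, r = q') ∧ ∃ k : ℤ, k ≠ 0 ∧ orb e n r = 1 / k := by
  obtain ⟨a, b, c, d, hdet, hden, hev⟩ := exists_eventually_orb_eq_mobius h0 h1 he hn
  have hden' : (c * q + d : ℝ) ≠ 0 := by exact_mod_cast hden
  have hab : (a * q + b : ℝ) = 0 := by
    rw [hev.self_of_nhds] at hz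
    exact (div_eq_zero_iff.1 hz).resolve_right hden'
  have ha : (a : ℝ) ≠ 0 := by
    intro ha
    have hb : (b : ℝ) = 0 := by simpa [ha] using hab
    apply hdet
    have ha' : a = 0 := by exact_mod_cast ha
    have hb' : b = 0 := by exact_mod_cast hb
    simp [ha', hb']
  have hq : (q : ℝ) = -b / a := by
    field_simp
    linarith
  have hinv : Tendsto (fun k : ℕ => ((k : ℝ))⁻¹) atTop (𝓝 0) := tendsto_inv_atTop_nhds_zero_nat
  have hlim : Tendsto (fun k : ℕ => (d * ((k : ℝ))⁻¹ - b) / (a - c * ((k : ℝ))⁻¹)) atTop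
      (𝓝 (q : ℝ)) := by
    have := ((hinv.const_mul (d : ℝ)).sub_const (b : ℝ)).div
      ((hinv.const_mul (c : ℝ)).const_sub (a : ℝ)) (by simpa using ha)
    simp only [mul_zero, sub_zero, zero_sub] at this
    rw [hq]
    exact this
  have hden2 : ∀ᶠ k : ℕ in atTop, (a - c * ((k : ℝ))⁻¹ : ℝ) ≠ 0 :=
    Tendsto.eventually_ne (by simpa using (hinv.const_mul (c : ℝ)).const_sub (a : ℝ)) ha
  have hden_ev : ∀ᶠ α : ℝ in 𝓝 (q : ℝ), (c * α + d : ℝ) ≠ 0 :=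
    ContinuousAt.eventually_ne (by fun_prop) hden'
  refine hlim.frequently (Eventually.frequently ?_)
  filter_upwards [hlim.eventually hev, hlim.eventually hden_ev, hden2, eventually_gt_atTop 0]
    with k hk1 hk2 hk3 hk4
  refine ⟨⟨(d * ((k : ℚ))⁻¹ - b) / (a - c * ((k : ℚ))⁻¹), by push_cast; rfl⟩, k,
    by exact_mod_cast hk4.ne', ?_⟩
  have hk : (k : ℝ) ≠ 0 := by exact_mod_cast hk4.ne'
  rw [hk1, div_eq_div_iff hk2 (by exact_mod_cast hk)]
  have hα := div_mul_cancel₀ (d * ((k : ℝ))⁻¹ - b : ℝ) hk3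
  push_cast
  set r : ℝ := (d * ((k : ℝ))⁻¹ - b) / (a - c * ((k : ℝ))⁻¹)
  field_simp at hα
  linear_combination hα

/-- If the reciprocals of the orbits of `α` and `α - 1` have constant integer sum near `q`, then
the next iterates have constant integer sum. -/
lemma exists_eventually_orb_succ_add (h0 : 0 < q) (h1 : q < 1) (hn : OrbNeZero 0 (n + 1) q)
    (hm : OrbNeZero 1 (m + 1) q) {c : ℤ}
    (hc : ∀ᶠ α in 𝓝 (q : ℝ), orb 0 n α + orb 1 m α = c * orb 0 n α * orb 1 m α) :
    ∃ d : ℤ, ∀ᶠ α in 𝓝 (q : ℝ), orb 0 (n + 1) α + orb 1 (m + 1) α = d := by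
  have hn' := hn n n.lt_succ_self
  have hm' := hm m m.lt_succ_self
  have hcn := continuousAt_orb h0 h1 (.inl rfl) (hn.mono n.le_succ)
  have hcm := continuousAt_orb h0 h1 (.inr rfl) (hm.mono m.le_succ)
  obtain ⟨k, hk⟩ := exists_eventually_orb_succ_eq h0 h1 (.inl rfl) hcn hn'
  obtain ⟨l, hl⟩ := exists_eventually_orb_succ_eq h0 h1 (.inr rfl) hcm hm'
  refine ⟨c - k - l, ?_⟩
  filter_upwards [hk, hl, hc, hcn.eventually_ne hn', hcm.eventually_ne hm'] with α h1 h2 h3 h4 h5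
  rw [h1, h2]
  push_cast
  field_simp
  linear_combination h3

end Germs

/-- Near `q`, the two critical orbits run opposite to each other up to the time when they hit zero
at the parameter `q`. -/
def DoubleZero (q : ℚ) (n m : ℕ) : Prop :=
  OrbNeZero 0 n q ∧ OrbNeZero 1 m q ∧ orb 0 n q = 0 ∧
    ∃ c : ℤ, ∀ᶠ α in 𝓝 (q : ℝ), orb 0 n α + orb 1 m α = c * orb 0 n α * orb 1 m α

/-- Near `q`, the two critical orbits are distinct, with reciprocals differing by an integer; hence
the next iterates agree. -/
def MatchingGerm (q : ℚ) : Prop :=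
  ∃ n m : ℕ, OrbNeZero 0 n q ∧ OrbNeZero 1 m q ∧
    ∃ c : ℤ, c ≠ 0 ∧ ∀ᶠ α in 𝓝 (q : ℝ), orb 0 n α - orb 1 m α = c * orb 0 n α * orb 1 m α

lemma DoubleZero.orb_one_eq_zero {q : ℚ} {n m : ℕ} (h : DoubleZero q n m) : orb 1 m q = 0 := by
  obtain ⟨-, -, hz, c, hc⟩ := h
  simpa [hz] using hc.self_of_nhds

/-- Near a double zero there are further double zeros, one step later. -/
lemma DoubleZero.frequently_succ {q : ℚ} {n m : ℕ} (h0 : 0 < q) (h1 : q < 1)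
    (h : DoubleZero q n m) :
    ∃ᶠ r : ℝ in 𝓝 (q : ℝ), r ≠ q ∧ ∃ q' : ℚ, r = q' ∧ 0 < q' ∧ q' < 1 ∧
      orb 0 n q' ≠ orb 1 m q' ∧ DoubleZero q' (n + 1) (m + 1) := by
  obtain ⟨hn, hm, hz, c, hc⟩ := h
  have hI : ∀ᶠ r : ℝ in 𝓝 (q : ℝ), r ∈ Ioo (0 : ℝ) 1 :=
    Ioo_mem_nhds (by exact_mod_cast h0) (by exact_mod_cast h1)
  have hlt : ∀ᶠ r : ℝ in 𝓝 (q : ℝ), c * orb 0 n r < 1 :=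
    ((continuousAt_orb h0 h1 (.inl rfl) hn).const_mul (c : ℝ)).eventually_lt
      continuousAt_const (by simp [hz])
  refine ((frequently_orb_eq_one_div h0 h1 (.inl rfl) hn hz).and_eventually
    (hI.and (hlt.and ((eventually_orbNeZero h0 h1 (.inl rfl) hn).and
    ((eventually_orbNeZero h0 h1 (.inr rfl) hm).and hc.eventually_nhds))))).mono ?_
  rintro r ⟨⟨⟨q', rfl⟩, k, hk, hk'⟩, hI, hlt, hn', hm', hc'⟩
  have h0' : 0 < q' := by exact_mod_cast hI.1
  have h1' : q' < 1 := by exact_mod_cast hI.2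
  have hkr : (k : ℝ) ≠ 0 := by exact_mod_cast hk
  have ha : orb 0 n q' ≠ 0 := by
    rw [hk']
    positivity
  have hcq := hc'.self_of_nhds
  have hb : orb 1 m q' ≠ 0 := by
    intro hb
    rw [hb] at hcq
    apply ha
    simpa using hcq
  have hTa : orb 0 (n + 1) q' = 0 := by
    have hk0 : 1 / orb 0 n q' - k = 0 := by rw [hk', one_div_one_div, sub_self]
    rw [orb_succ, T_eq_of_mem (k := k) ha, hk0]
    rw [hk0]
    constructor <;> linarith [hI.1, hI.2]
  have hTb : orb 1 (m + 1) q' = 0 := by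
    have hk0 : 1 / orb 1 m q' - ((c - k : ℤ) : ℝ) = 0 := by
      rw [hk'] at hcq
      field_simp at hcq
      push_cast
      field_simp
      linear_combination hcq
    rw [orb_succ, T_eq_of_mem (k := c - k) hb, hk0]
    rw [hk0]
    constructor <;> linarith [hI.1, hI.2]
  obtain ⟨d, hd⟩ := exists_eventually_orb_succ_add h0' h1' (hn'.succ ha) (hm'.succ hb) hc'
  have hd0 : (d : ℝ) = 0 := by
    rw [← hd.self_of_nhds, hTa, hTb, add_zero]
  refine ⟨?_, q', rfl, h0', h1', ?_, hn'.succ ha, hm'.succ hb, hTa, 0, ?_⟩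
  · intro h
    rw [h] at ha
    exact ha hz
  · intro h
    rw [← h] at hcq
    have : orb 0 n q' * (2 - c * orb 0 n q') = 0 := by linear_combination hcq
    rcases mul_eq_zero.1 this with h | h
    · exact ha h
    · linarith
  · simpa [hd0] using hd

lemma DoubleZero.frequently_add {q : ℚ} {n m : ℕ} (h0 : 0 < q) (h1 : q < 1)
    (h : DoubleZero q n m) (j : ℕ) :
    ∃ᶠ r : ℝ in 𝓝 (q : ℝ), ∃ q' : ℚ, r = q' ∧ 0 < q' ∧ q' < 1 ∧
      orb 0 (n + j) q' ≠ orb 1 (m + j) q' ∧ DoubleZero q' (n + j + 1) (m + j + 1) := by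
  induction j with
  | zero => exact (h.frequently_succ h0 h1).mono fun r hr => hr.2
  | succ j ih =>
    refine frequently_frequently_nhds.1 (ih.mono ?_)
    rintro r ⟨q', rfl, h0', h1', -, hq'⟩
    exact (hq'.frequently_succ h0' h1').mono fun r hr => hr.2

lemma orb_add_eq {α : ℝ} {N M : ℕ} (h : orb 1 M α = orb 0 N α) (j : ℕ) :
    orb 1 (M + j) α = orb 0 (N + j) α := by
  induction j with
  | zero => exact h
  | succ j ih => rw [← add_assoc, ← add_assoc, orb_succ, orb_succ, ih]

lemma orb_zero_eq (N : ℕ) (α : ℝ) : orb 0 N α = (T α)^[N] α := by simp [orb]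

lemma orb_one_eq (N : ℕ) (α : ℝ) : orb 1 N α = (T α)^[N] (α - 1) := by simp [orb]

lemma DoubleZero.notMem_matchingSet {q : ℚ} {n m : ℕ} (h0 : 0 < q) (h1 : q < 1)
    (h : DoubleZero q n m) : (q : ℝ) ∉ MatchingSet := by
  rintro ⟨J, M, N, ⟨⟨a, b, -, rfl⟩, -, hMN, -⟩, hq⟩
  have hJ : ∀ᶠ r : ℝ in 𝓝 (q : ℝ), r ∈ Ioo a b := Ioo_mem_nhds hq.1 hq.2
  obtain ⟨r, ⟨q', rfl, h0', h1', hne, hq'⟩, hr⟩ :=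
    ((h.frequently_add h0 h1 (N + M)).and_eventually hJ).exists
  have hmatch : orb 1 M q' = orb 0 N q' := by
    rw [orb_one_eq, orb_zero_eq]
    exact hMN _ hr
  have hz1 := hq'.orb_one_eq_zero
  obtain ⟨hn, hm, hz, -⟩ := hq'
  have hdiff : n + M = m + N := by
    have e1 := orb_add_eq hmatch (n + (N + M) + 1 - N)
    rw [show N + (n + (N + M) + 1 - N) = n + (N + M) + 1 by lia, hz] at e1
    have e2 := orb_add_eq hmatch (m + (N + M) + 1 - M)
    rw [show M + (m + (N + M) + 1 - M) = m + (N + M) + 1 by lia, hz1] at e2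
    have i1 : ¬ (M + (n + (N + M) + 1 - N) < m + (N + M) + 1) := fun hlt => hm _ hlt e1
    have i2 : ¬ (N + (m + (N + M) + 1 - M) < n + (N + M) + 1) := fun hlt => hn _ hlt e2.symm
    lia
  have e3 := orb_add_eq hmatch (n + M)
  rw [show M + (n + M) = m + (N + M) by lia, show N + (n + M) = n + (N + M) by lia] at e3
  exact hne e3.symm

lemma ratCast_mem_Icc {q : ℚ} (h0 : 0 < q) (h1 : q < 1) : (q : ℝ) ∈ Icc (0 : ℝ) 1 :=
  ⟨by exact_mod_cast h0.le, by exact_mod_cast h1.le⟩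

lemma DoubleZero.mem_E {q : ℚ} {n m : ℕ} (h0 : 0 < q) (h1 : q < 1)
    (h : DoubleZero q n m) : (q : ℝ) ∈ E ∩ Set.range ((↑) : ℚ → ℝ) :=
  ⟨⟨ratCast_mem_Icc h0 h1, h.notMem_matchingSet h0 h1⟩, q, rfl⟩

lemma DoubleZero.mem_closure {q : ℚ} {n m : ℕ} (h0 : 0 < q) (h1 : q < 1)
    (h : DoubleZero q n m) :
    (q : ℝ) ∈ closure ((E ∩ Set.range ((↑) : ℚ → ℝ)) \ {(q : ℝ)}) := by
  rw [mem_closure_iff_frequently]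
  refine (h.frequently_succ h0 h1).mono ?_
  rintro r ⟨hne, q', rfl, h0', h1', -, hq'⟩
  exact ⟨hq'.mem_E h0' h1', hne⟩

/-- Any interval on which the two matching conditions hold is contained in a maximal one. -/
lemma mem_matchingSet_of_Ioo {x a b : ℝ} {M N : ℕ} (hx : x ∈ Ioo a b) (hab : Ioo a b ⊆ Icc 0 1)
    (h1 : ∀ α ∈ Ioo a b, (T α)^[M] (α - 1) = (T α)^[N] α)
    (h2 : ∀ᵐ α ∂(volume.restrict (Ioo a b)), (T α)^[M - 1] (α - 1) ≠ (T α)^[N - 1] α) :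
    x ∈ MatchingSet := by
  let S : Set (Set ℝ) := {J | (∃ a b : ℝ, a < b ∧ J = Set.Ioo a b) ∧ J ⊆ Set.Icc 0 1 ∧
    (∀ α ∈ J, (T α)^[M] (α - 1) = (T α)^[N] α) ∧
    (∀ᵐ α ∂(volume.restrict J), (T α)^[M - 1] (α - 1) ≠ (T α)^[N - 1] α) ∧ x ∈ J}
  have hS : Ioo a b ∈ S := ⟨⟨a, b, hx.1.trans hx.2, rfl⟩, hab, h1, h2, hx⟩
  have hopen : ∀ J ∈ S, IsOpen J := by
    rintro J ⟨⟨a, b, -, rfl⟩, -⟩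
    exact isOpen_Ioo
  have hxU : x ∈ ⋃₀ S := ⟨_, hS, hx⟩
  have hUo : IsOpen (⋃₀ S) := isOpen_sUnion hopen
  have hUc : IsPreconnected (⋃₀ S) := by
    refine isPreconnected_sUnion x S (fun J hJ => hJ.2.2.2.2) ?_
    rintro J ⟨⟨a, b, -, rfl⟩, -⟩
    exact isPreconnected_Ioo
  have hUI : ⋃₀ S ⊆ Icc 0 1 := sUnion_subset fun J hJ => hJ.2.1
  have hbb : BddBelow (⋃₀ S) := bddBelow_Icc.mono hUI
  have hba : BddAbove (⋃₀ S) := bddAbove_Icc.mono hUI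
  have hUeq : ⋃₀ S = Ioo (sInf (⋃₀ S)) (sSup (⋃₀ S)) := by
    refine Subset.antisymm (fun y hy => ?_) (IsConnected.Ioo_csInf_csSup_subset ⟨⟨x, hxU⟩, hUc⟩ hbb hba)
    have hmem := hUo.mem_nhds hy
    obtain ⟨u, v, huv, hsub⟩ := mem_nhds_iff_exists_Ioo_subset.1 hmem
    obtain ⟨w, hw⟩ := exists_between huv.1
    obtain ⟨z, hz⟩ := exists_between huv.2
    exact ⟨(csInf_le hbb (hsub ⟨hw.1, hw.2.trans huv.2⟩)).trans_lt hw.2,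
      hz.1.trans_le (le_csSup hba (hsub ⟨huv.1.trans hz.1, hz.2⟩))⟩
  refine ⟨⋃₀ S, M, N, ⟨⟨_, _, ?_, hUeq⟩, hUI, ?_, ?_, ?_⟩, hxU⟩
  · rw [hUeq] at hxU
    exact hxU.1.trans hxU.2
  · rintro α ⟨J, hJ, hα⟩
    exact hJ.2.2.1 α hα
  · obtain ⟨C, hCc, hCS, hCU⟩ := TopologicalSpace.isOpen_sUnion_countable S hopen
    rw [← hCU, sUnion_eq_biUnion, ae_restrict_biUnion_iff _ hCc]
    exact fun J hJ => (hCS hJ).2.2.2.1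
  · intro J' hJ1 hJ2 hJ3 hJ4 hJ5
    exact Subset.antisymm (subset_sUnion_of_mem ⟨hJ1, hJ2, hJ3, hJ4, hJ5 hxU⟩) hJ5

lemma MatchingGerm.mem_matchingSet {q : ℚ} (h0 : 0 < q) (h1 : q < 1) (h : MatchingGerm q) :
    (q : ℝ) ∈ MatchingSet := by
  obtain ⟨n, m, hn, hm, c, hc, hev⟩ := h
  have hI : ∀ᶠ r : ℝ in 𝓝 (q : ℝ), r ∈ Icc (0 : ℝ) 1 :=
    Icc_mem_nhds (by exact_mod_cast h0) (by exact_mod_cast h1)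
  have hne := eventually_nhdsWithin_iff.1 (eventually_orb_ne_zero h0 h1 (.inl rfl) hn)
  obtain ⟨a, b, hq, hab⟩ := mem_nhds_iff_exists_Ioo_subset.1 (hI.and (hne.and hev))
  refine mem_matchingSet_of_Ioo (M := m + 1) (N := n + 1) hq (fun r hr => (hab hr).1) ?_ ?_
  · intro α hα
    rw [← orb_one_eq, ← orb_zero_eq, orb_succ, orb_succ]
    exact (T_eq_T_of_sub (hab hα).2.2).symm
  · have hq' : ∀ᵐ α ∂(volume.restrict (Ioo a b)), α ≠ (q : ℝ) :=
      ae_restrict_of_ae (Measure.ae_ne volume (q : ℝ))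
    filter_upwards [hq', ae_restrict_mem measurableSet_Ioo] with α h3 h4
    obtain ⟨-, h5, h6⟩ := hab h4
    simp only [Nat.add_sub_cancel, ← orb_one_eq, ← orb_zero_eq]
    intro heq
    rw [heq, sub_self] at h6
    have hc' : (c : ℝ) ≠ 0 := by exact_mod_cast hc
    exact mul_ne_zero (mul_ne_zero hc' (h5 h3)) (h5 h3) h6.symm

section Reflection

variable {q : ℚ}

lemma eventually_orb_one_sub (h0 : 0 < q) (h1 : q < 1) {e : ℤ} (he : e = 0 ∨ e = 1) {n : ℕ}
    (hn : OrbNeZero e n q) :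
    ∀ᶠ α in 𝓝 (q : ℝ), orb (1 - e) n (1 - α) = -orb e n α := by
  induction n with
  | zero =>
    refine Eventually.of_forall fun α => ?_
    simp only [orb_zero]
    push_cast
    ring
  | succ n ih =>
    have hne := ((continuousAt_orb h0 h1 he hn).sub
      (continuousAt_id.sub (continuousAt_const (y := (1 : ℝ))))).eventually_ne
      (sub_ne_zero.2 (orb_succ_ne_sub_one h0 h1 he n))
    filter_upwards [ih (hn.mono n.le_succ), hne] with α h2 h3
    rw [orb_succ, h2, orb_succ]
    refine T_one_sub_neg fun h => h3 ?_
    simp [orb_succ, h]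

lemma orbNeZero_one_sub (h0 : 0 < q) (h1 : q < 1) {e : ℤ} (he : e = 0 ∨ e = 1) {n : ℕ}
    (hn : OrbNeZero e n q) : OrbNeZero (1 - e) n ((1 - q : ℚ) : ℝ) := by
  intro i hi
  have := (eventually_orb_one_sub h0 h1 he (hn.mono hi.le)).self_of_nhds
  push_cast
  rw [this]
  exact neg_ne_zero.2 (hn i hi)

lemma tendsto_one_sub_ratCast (q : ℚ) :
    Tendsto (fun α : ℝ => 1 - α) (𝓝 ((1 - q : ℚ) : ℝ)) (𝓝 (q : ℝ)) := by
  have : ContinuousAt (fun α : ℝ => 1 - α) ((1 - q : ℚ) : ℝ) := by fun_prop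
  simpa [ContinuousAt] using this

lemma MatchingGerm.one_sub (h0 : 0 < q) (h1 : q < 1) (h : MatchingGerm q) :
    MatchingGerm (1 - q) := by
  obtain ⟨n, m, hn, hm, c, hc, hev⟩ := h
  refine ⟨m, n, orbNeZero_one_sub h0 h1 (.inr rfl) hm, orbNeZero_one_sub h0 h1 (.inl rfl) hn,
    c, hc, ?_⟩
  filter_upwards [(tendsto_one_sub_ratCast q).eventually (hev.and
    ((eventually_orb_one_sub h0 h1 (.inl rfl) hn).and
    (eventually_orb_one_sub h0 h1 (.inr rfl) hm)))] with α hα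
  obtain ⟨h3, h4, h5⟩ := hα
  simp only [sub_sub_cancel, sub_zero, sub_self] at h4 h5
  rw [h4, h5]
  linear_combination h3

lemma DoubleZero.one_sub {n m : ℕ} (h0 : 0 < q) (h1 : q < 1) (h : DoubleZero q n m) :
    DoubleZero (1 - q) m n := by
  have hz1 := h.orb_one_eq_zero
  obtain ⟨hn, hm, hz, c, hev⟩ := h
  refine ⟨orbNeZero_one_sub h0 h1 (.inr rfl) hm, orbNeZero_one_sub h0 h1 (.inl rfl) hn, ?_,
    -c, ?_⟩
  · have := (eventually_orb_one_sub h0 h1 (.inr rfl) hm).self_of_nhds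
    rw [hz1] at this
    simpa using this
  filter_upwards [(tendsto_one_sub_ratCast q).eventually (hev.and
    ((eventually_orb_one_sub h0 h1 (.inl rfl) hn).and
    (eventually_orb_one_sub h0 h1 (.inr rfl) hm)))] with α hα
  obtain ⟨h3, h4, h5⟩ := hα
  simp only [sub_sub_cancel, sub_zero, sub_self] at h4 h5
  rw [h4, h5]
  push_cast
  linear_combination -h3

end Reflection

lemma eventually_orb_succ_eq {q : ℚ} {e : ℤ} {n : ℕ} (h0 : 0 < q) (h1 : q < 1)
    (he : e = 0 ∨ e = 1) (hn : OrbNeZero e (n + 1) q) {k : ℤ}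
    (hk : 1 / orb e n q - k ∈ Ico ((q : ℝ) - 1) q) :
    ∀ᶠ α in 𝓝 (q : ℝ), orb e (n + 1) α = 1 / orb e n α - k := by
  have hn' := hn n n.lt_succ_self
  obtain ⟨l, hl⟩ := exists_eventually_orb_succ_eq h0 h1 he
    (continuousAt_orb h0 h1 he (hn.mono n.le_succ)) hn'
  have heq := hl.self_of_nhds
  rw [orb_succ, T_eq_of_mem hn' hk] at heq
  have hkl : (k : ℝ) = l := by linarith
  simpa [hkl] using hl

/-- Near `q`, the two critical orbits have reciprocals with constant integer sum, with a time
difference of one. -/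
def OppositeGerm (q : ℚ) (m : ℕ) : Prop :=
  OrbNeZero 0 (m + 1) q ∧ OrbNeZero 1 m q ∧
    ∃ c : ℤ, ∀ᶠ α in 𝓝 (q : ℝ), orb 0 (m + 1) α + orb 1 m α = c * orb 0 (m + 1) α * orb 1 m α

section Classification

variable {q : ℚ}

lemma OppositeGerm.step {m : ℕ} (h0 : 0 < q) (h1 : q < 1) (hg : (1 : ℝ) < q * (1 + q))
    (h : OppositeGerm q m) :
    (∃ n m, DoubleZero q n m) ∨ MatchingGerm q ∨ OppositeGerm q (m + 1) ∨ OppositeGerm q (m + 2) := by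
  have h0' : (0 : ℝ) < q := by exact_mod_cast h0
  have h1' : (q : ℝ) < 1 := by exact_mod_cast h1
  obtain ⟨hn, hm, c, hc⟩ := h
  by_cases ha : orb 0 (m + 1) q = 0
  · exact .inl ⟨m + 1, m, hn, hm, ha, c, hc⟩
  have hb : orb 1 m q ≠ 0 := by
    intro hb
    have := hc.self_of_nhds
    rw [hb] at this
    exact ha (by simpa using this)
  right
  have hn := hn.succ ha
  have hm := hm.succ hb
  obtain ⟨d, hd⟩ := exists_eventually_orb_succ_add h0 h1 hn hm hc
  have hy := orb_succ_mem_Ioo h0 h1 (.inl rfl) (m + 1)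
  have hy' := orb_succ_mem_Ioo h0 h1 (.inr rfl) m
  have hdq := hd.self_of_nhds
  have hd01 : d = 0 ∨ d = 1 := by
    have e2 : (d : ℝ) < 2 := by linarith [hy.2, hy'.2]
    have hhalf : (1 / 2 : ℝ) < q := by nlinarith
    have e3 : (-1 : ℝ) < d := by linarith [hy.1, hy'.1]
    have e2' : d < 2 := by exact_mod_cast e2
    have e3' : -1 < d := by exact_mod_cast e3
    lia
  rcases hd01 with rfl | rfl
  · right; left
    exact ⟨hn, hm, 0, by simpa using hd⟩
  rw [Int.cast_one] at hdq hd
  have hypos : 0 < orb 0 (m + 1 + 1) q := by linarith [hy'.2]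
  have hypos' : 0 < orb 1 (m + 1) q := by linarith [hy.2]
  have hn2 := hn.succ hypos.ne'
  have hm2 := hm.succ hypos'.ne'
  have hnz := eventually_orbNeZero h0 h1 (.inl rfl) hn2
  have hmz := eventually_orbNeZero h0 h1 (.inr rfl) hm2
  by_cases hA : 1 < orb 0 (m + 1 + 1) q * (1 + q)
  · left
    have hT := eventually_orb_succ_eq h0 h1 (.inl rfl) hn2 (k := 1) (by
      push_cast
      constructor
      · rw [le_sub_iff_add_le, le_div_iff₀ hypos]
        nlinarith [hy.2]
      · rw [sub_lt_iff_lt_add, div_lt_iff₀ hypos]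
        linarith)
    refine ⟨m + 1 + 1 + 1, m + 1, hn2, hm, 1, one_ne_zero, ?_⟩
    filter_upwards [hT, hd, hnz] with α e1 e2 e3
    have e4 := e3 (m + 1 + 1) (Nat.lt_succ_self _)
    have e5 : orb 1 (m + 1) α = 1 - orb 0 (m + 1 + 1) α := by linarith
    rw [e1, e5]
    push_cast
    field_simp
  by_cases hB : 1 < orb 1 (m + 1) q * (1 + q)
  · left
    have hT := eventually_orb_succ_eq h0 h1 (.inr rfl) hm2 (k := 1) (by
      push_cast
      constructor
      · rw [le_sub_iff_add_le, le_div_iff₀ hypos']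
        nlinarith [hy'.2]
      · rw [sub_lt_iff_lt_add, div_lt_iff₀ hypos']
        linarith)
    refine ⟨m + 1 + 1, m + 1 + 1, hn, hm2, -1, by norm_num, ?_⟩
    filter_upwards [hT, hd, hmz] with α e1 e2 e3
    have e4 := e3 (m + 1) (Nat.lt_succ_self _)
    have e5 : orb 0 (m + 1 + 1) α = 1 - orb 1 (m + 1) α := by linarith
    rw [e1, e5]
    push_cast
    field_simp
    ring
  have hT := eventually_orb_succ_eq h0 h1 (.inl rfl) hn2 (k := 2) (by
      push_cast
      constructor
      · rw [le_sub_iff_add_le, le_div_iff₀ hypos]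
        linarith
      · rw [sub_lt_iff_lt_add, div_lt_iff₀ hypos]
        nlinarith)
  have hT' := eventually_orb_succ_eq h0 h1 (.inr rfl) hm2 (k := 2) (by
      push_cast
      constructor
      · rw [le_sub_iff_add_le, le_div_iff₀ hypos']
        linarith
      · rw [sub_lt_iff_lt_add, div_lt_iff₀ hypos']
        nlinarith)
  right; right
  refine ⟨hn2, hm2, -1, ?_⟩
  filter_upwards [hT, hT', hd, hnz, hmz] with α e1 e2 e3 e4 e5
  have e6 := e4 (m + 1 + 1) (Nat.lt_succ_self _)
  have e7 := e5 (m + 1) (Nat.lt_succ_self _)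
  have e8 : orb 0 (m + 1 + 1) α = 1 - orb 1 (m + 1) α := by linarith
  rw [e8] at e1 e6
  rw [e1, e2]
  push_cast
  field_simp
  ring

lemma OppositeGerm.doubleZero_or_matchingGerm (h0 : 0 < q) (h1 : q < 1)
    (hg : (1 : ℝ) < q * (1 + q)) (j : ℕ) :
    ∀ m, q.den < m + j → OppositeGerm q m → (∃ n m, DoubleZero q n m) ∨ MatchingGerm q := by
  induction j using Nat.strong_induction_on with
  | _ j ih =>
    intro m hj h
    have hm : ¬ q.den < m := fun hlt => h.2.1 _ hlt (orb_den_eq_zero h0 h1 (.inr rfl))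
    rcases h.step h0 h1 hg with h | h | h | h
    · exact .inl h
    · exact .inr h
    · exact ih (j - 1) (by lia) (m + 1) (by lia) h
    · exact ih (j - 2) (by lia) (m + 2) (by lia) h

lemma opposite_zero (h0 : 0 < q) (h1 : q < 1) (hg : (1 : ℝ) < q * (1 + q)) : OppositeGerm q 0 := by
  have h0' : (0 : ℝ) < q := by exact_mod_cast h0
  have h1' : (q : ℝ) < 1 := by exact_mod_cast h1
  have hn : OrbNeZero 0 (0 + 1) q := by
    intro i hi
    obtain rfl : i = 0 := by lia
    simpa [orb_zero] using h0'.ne'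
  have hT := eventually_orb_succ_eq h0 h1 (.inl rfl) hn (k := 1) (by
    simp only [orb_zero, Int.cast_zero, sub_zero, Int.cast_one]
    constructor
    · rw [le_sub_iff_add_le, le_div_iff₀ h0']
      nlinarith
    · rw [sub_lt_iff_lt_add, div_lt_iff₀ h0']
      linarith)
  refine ⟨hn, fun i hi => absurd hi (Nat.not_lt_zero i), -1, ?_⟩
  filter_upwards [hT, eventually_ne_nhds h0'.ne'] with α e1 e2
  rw [e1]
  simp only [orb_zero]
  push_cast
  rw [sub_zero]
  field_simp
  ring

lemma matchingGerm_of_le_golden (h2 : 1 / 2 ≤ q) (hg : (q : ℝ) * (1 + q) ≤ 1) :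
    MatchingGerm q := by
  have h2' : (1 / 2 : ℝ) ≤ q := by
    have := (Rat.cast_le (K := ℝ)).2 h2
    push_cast at this
    exact this
  have h0' : (0 : ℝ) < q := by linarith
  have h1' : (q : ℝ) < 1 := by nlinarith
  have h0 : 0 < q := by exact_mod_cast h0'
  have h1 : q < 1 := by exact_mod_cast h1'
  have hneg : (0 : ℝ) < 1 - q := by linarith
  have hn : OrbNeZero 0 (0 + 1) q := by
    intro i hi
    obtain rfl : i = 0 := by lia
    simpa [orb_zero] using h0'.ne'
  have hm : OrbNeZero 1 (0 + 1) q := by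
    intro i hi
    obtain rfl : i = 0 := by lia
    simpa [orb_zero] using (sub_neg.2 h1').ne
  have hinv : 1 / ((q : ℝ) - 1) = -(1 / (1 - q)) := by rw [← neg_sub, div_neg]
  have hT := eventually_orb_succ_eq h0 h1 (.inl rfl) hn (k := 2) (by
    simp only [orb_zero, Int.cast_zero, sub_zero, Int.cast_ofNat]
    constructor
    · rw [le_sub_iff_add_le, le_div_iff₀ h0']
      linarith
    · rw [sub_lt_iff_lt_add, div_lt_iff₀ h0']
      nlinarith)
  have hα : ∀ᶠ α : ℝ in 𝓝 (q : ℝ), α ≠ 0 := eventually_ne_nhds h0'.ne'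
  have hα' : ∀ᶠ α : ℝ in 𝓝 (q : ℝ), α - 1 ≠ 0 :=
    (eventually_ne_nhds h1'.ne).mono fun α h => sub_ne_zero.2 h
  by_cases hA : (q : ℝ) - 1 ≤ 1 / (q - 1) + 2
  · have hT' := eventually_orb_succ_eq h0 h1 (.inr rfl) hm (k := -2) (by
      simp only [orb_zero, Int.cast_one, Int.cast_neg, Int.cast_ofNat, sub_neg_eq_add]
      refine ⟨hA, ?_⟩
      have : 2 - (q : ℝ) < 1 / (1 - q) := by
        rw [lt_div_iff₀ hneg]
        nlinarith
      linarith)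
    refine ⟨0 + 1, 0 + 1, hn, hm, 1, one_ne_zero, ?_⟩
    filter_upwards [hT, hT', hα, hα'] with α e1 e2 e3 e4
    rw [e1, e2]
    simp only [orb_zero]
    push_cast
    rw [sub_zero]
    field_simp
    ring
  rw [not_le] at hA
  have hA' : (q : ℝ) ^ 2 - 4 * q + 2 < 0 := by
    have h3 : 3 - (q : ℝ) < 1 / (1 - q) := by linarith
    rw [lt_div_iff₀ hneg] at h3
    nlinarith
  have hlow : (0.58 : ℝ) < q := by nlinarith
  have hup : (q : ℝ) < 0.62 := by nlinarith
  have hT' := eventually_orb_succ_eq h0 h1 (.inr rfl) hm (k := -3) (by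
    simp only [orb_zero, Int.cast_one, Int.cast_neg, Int.cast_ofNat, sub_neg_eq_add]
    refine ⟨?_, by linarith⟩
    have : 1 / (1 - q) ≤ 4 - (q : ℝ) := by
      rw [div_le_iff₀ hneg]
      nlinarith
    linarith)
  have hv := hT.self_of_nhds
  have hv' := hT'.self_of_nhds
  simp only [orb_zero, Int.cast_zero, sub_zero, Int.cast_ofNat] at hv
  simp only [orb_zero, Int.cast_one, Int.cast_neg, Int.cast_ofNat, sub_neg_eq_add] at hv'
  have hd1 : (1 - 2 * q : ℝ) < 0 := by linarith
  have hd2 : (3 * q - 2 : ℝ) < 0 := by linarith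
  have hgne : (q : ℝ) * (1 + q) ≠ 1 := by
    intro h
    apply orb_succ_ne_sub_one h0 h1 (.inl rfl) 0
    rw [hv]
    field_simp
    linarith
  have hglt := lt_of_le_of_ne hg hgne
  have hvq : orb 0 (0 + 1) q = (1 - 2 * q) / q := by
    rw [hv]
    field_simp
  have hvq' : orb 1 (0 + 1) q = (3 * q - 2) / (q - 1) := by
    have : (q : ℝ) - 1 ≠ 0 := by linarith
    rw [hv']
    field_simp
    ring
  have hn2 := hn.succ (by rw [hvq]; exact (div_neg_of_neg_of_pos hd1 h0').ne)
  have hm2 := hm.succ (by rw [hvq']; exact (div_pos_of_neg_of_neg hd2 (by linarith)).ne')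
  have hT2 := eventually_orb_succ_eq h0 h1 (.inl rfl) hn2 (k := -3) (by
    have : 1 / orb 0 (0 + 1) q - ((-3 : ℤ) : ℝ) = (5 * q - 3) / (2 * q - 1) := by
      have h3 : (2 * q - 1 : ℝ) ≠ 0 := by linarith
      rw [hvq, one_div_div, div_sub' hd1.ne, div_eq_div_iff hd1.ne h3]
      push_cast
      ring
    have h3 : (0 : ℝ) < 2 * q - 1 := by linarith
    rw [this]
    constructor
    · rw [le_div_iff₀ h3]
      nlinarith
    · rw [div_lt_iff₀ h3]
      nlinarith)
  have hT2' := eventually_orb_succ_eq h0 h1 (.inr rfl) hm2 (k := 2) (by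
    have : 1 / orb 1 (0 + 1) q - ((2 : ℤ) : ℝ) = (5 * q - 3) / (2 - 3 * q) := by
      have h3 : (2 - 3 * q : ℝ) ≠ 0 := by linarith
      rw [hvq', one_div_div, div_sub' hd2.ne, div_eq_div_iff hd2.ne h3]
      push_cast
      ring
    have h3 : (0 : ℝ) < 2 - 3 * q := by linarith
    rw [this]
    constructor
    · rw [le_div_iff₀ h3]
      nlinarith
    · rw [div_lt_iff₀ h3]
      nlinarith)
  refine ⟨0 + 1 + 1, 0 + 1 + 1, hn2, hm2, -1, by norm_num, ?_⟩
  filter_upwards [hT, hT', hT2, hT2', hα, hα', eventually_orbNeZero h0 h1 (.inl rfl) hn2,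
    eventually_orbNeZero h0 h1 (.inr rfl) hm2] with α e1 e2 e3 e4 e5 e6 e7 e8
  have e9 := e7 (0 + 1) (Nat.lt_succ_self _)
  have e10 := e8 (0 + 1) (Nat.lt_succ_self _)
  simp only [orb_zero] at e1 e2
  push_cast at e1 e2
  rw [sub_zero] at e1
  have key : orb 0 (0 + 1) α * orb 1 (0 + 1) α - 2 * orb 0 (0 + 1) α + orb 1 (0 + 1) α - 1
      = 0 := by
    rw [e1, e2]
    field_simp
    ring
  rw [e3, e4]
  push_cast
  field_simp
  linear_combination -key

/-- A rational parameter is either a double zero or has a matching germ. -/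
lemma exists_doubleZero_or_matchingGerm (h0 : 0 < q) (h1 : q < 1) :
    (∃ n m, DoubleZero q n m) ∨ MatchingGerm q := by
  have key : ∀ q : ℚ, q < 1 → 1 / 2 ≤ q → (∃ n m, DoubleZero q n m) ∨ MatchingGerm q := by
    intro q h1 h2
    have h0 : 0 < q := by linarith
    rcases le_or_gt ((q : ℝ) * (1 + q)) 1 with hg | hg
    · exact .inr (matchingGerm_of_le_golden h2 hg)
    · exact OppositeGerm.doubleZero_or_matchingGerm h0 h1 hg (q.den + 1) 0 (by lia)
        (opposite_zero h0 h1 hg)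
  rcases le_or_gt (1 / 2) q with h2 | h2
  · exact key q h1 h2
  · have e1 : 1 - q < 1 := by linarith
    have e0 : 0 < 1 - q := by linarith
    rcases key (1 - q) e1 (by linarith) with ⟨n, m, h⟩ | h
    · left
      exact ⟨m, n, by simpa using h.one_sub e0 e1⟩
    · right
      simpa using h.one_sub e0 e1

end Classification

lemma doubleZero_div_add_one {k : ℕ} (hk : 2 ≤ k) : DoubleZero (k / (k + 1)) 2 1 := by
  have hk' : (2 : ℝ) ≤ k := by exact_mod_cast hk
  have hkq : (2 : ℚ) ≤ k := by exact_mod_cast hk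
  have h0 : (0 : ℚ) < k / (k + 1) := by positivity
  have h1 : (k / (k + 1) : ℚ) < 1 := by
    rw [div_lt_one (by positivity)]
    linarith
  set q : ℚ := k / (k + 1) with hq
  have hqr : (q : ℝ) = k / (k + 1) := by
    rw [hq]
    push_cast
    rfl
  have h0' : (0 : ℝ) < q := by exact_mod_cast h0
  have h1' : (q : ℝ) < 1 := by exact_mod_cast h1
  have hg : (1 : ℝ) < q * (1 + q) := by
    have : (q : ℝ) * (1 + q) = (k * (2 * k + 1)) / (k + 1) ^ 2 := by
      rw [hqr]
      field_simp
      ring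
    rw [this, lt_div_iff₀ (by positivity)]
    nlinarith
  obtain ⟨hn, hm, c, hc⟩ := opposite_zero h0 h1 hg
  have ha : orb 0 (0 + 1) q = 1 / k := by
    have hz : 1 / (q : ℝ) - ((1 : ℤ) : ℝ) = 1 / k := by
      rw [hqr]
      push_cast
      field_simp
      ring
    have hle : 1 / (k : ℝ) < q := by
      rw [hqr, div_lt_div_iff₀ (by positivity) (by positivity)]
      nlinarith
    have hpos : 0 < 1 / (k : ℝ) := by positivity
    rw [orb_succ, orb_zero, Int.cast_zero, sub_zero, T_eq_of_mem h0'.ne', hz]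
    rw [hz]
    constructor <;> linarith
  have hb : orb 1 0 q = -1 / (k + 1) := by
    rw [orb_zero, hqr]
    push_cast
    field_simp
    ring
  have hn2 := hn.succ (by rw [ha]; positivity)
  have hm2 := hm.succ (by rw [hb]; exact (div_neg_of_neg_of_pos (by norm_num) (by positivity)).ne)
  have hTa : orb 0 (0 + 1 + 1) q = 0 := by
    have hz : 1 / orb 0 (0 + 1) q - ((k : ℤ) : ℝ) = 0 := by
      rw [ha]
      simp
    rw [orb_succ, T_eq_of_mem (hn2 _ (Nat.lt_succ_self _)), hz]
    rw [hz]
    constructor <;> linarith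
  have hTb : orb 1 (0 + 1) q = 0 := by
    have hz : 1 / orb 1 0 q - ((-(k + 1) : ℤ) : ℝ) = 0 := by
      rw [hb]
      push_cast
      field_simp
      ring
    rw [orb_succ, T_eq_of_mem (hm2 _ (Nat.lt_succ_self _)), hz]
    rw [hz]
    constructor <;> linarith
  obtain ⟨d, hd⟩ := exists_eventually_orb_succ_add h0 h1 hn2 hm2 hc
  have hd0 : (d : ℝ) = 0 := by rw [← hd.self_of_nhds, hTa, hTb, add_zero]
  exact ⟨hn2, hm2, hTa, 0, by simpa [hd0] using hd⟩

lemma eventually_doubleZero_div_add_one : ∀ᶠ k : ℕ in atTop,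
    (0 : ℚ) < k / (k + 1) ∧ (k / (k + 1) : ℚ) < 1 ∧ DoubleZero (k / (k + 1)) 2 1 := by
  filter_upwards [eventually_ge_atTop 2] with k hk
  have hk' : (2 : ℚ) ≤ k := by exact_mod_cast hk
  refine ⟨by positivity, ?_, doubleZero_div_add_one hk⟩
  rw [div_lt_one (by positivity)]
  linarith

lemma one_mem_closure_E :
    (1 : ℝ) ∈ closure ((E ∩ Set.range ((↑) : ℚ → ℝ)) \ {1}) := by
  refine mem_closure_of_tendsto (tendsto_natCast_div_add_atTop (1 : ℝ)) ?_
  filter_upwards [eventually_doubleZero_div_add_one] with k ⟨h0, h1, h⟩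
  have hcast : (k / (k + 1) : ℝ) = ((k / (k + 1) : ℚ) : ℝ) := by push_cast; rfl
  rw [hcast]
  exact ⟨h.mem_E h0 h1, fun hk => h1.ne (by exact_mod_cast mem_singleton_iff.1 hk)⟩

lemma zero_mem_closure_E :
    (0 : ℝ) ∈ closure ((E ∩ Set.range ((↑) : ℚ → ℝ)) \ {0}) := by
  have hlim := (tendsto_natCast_div_add_atTop (1 : ℝ)).const_sub (1 : ℝ)
  rw [sub_self] at hlim
  refine mem_closure_of_tendsto hlim ?_
  filter_upwards [eventually_doubleZero_div_add_one] with k ⟨h0, h1, h⟩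
  have hcast : (1 - k / (k + 1) : ℝ) = ((1 - k / (k + 1) : ℚ) : ℝ) := by push_cast; rfl
  rw [hcast]
  have h0' : (0 : ℚ) < 1 - k / (k + 1) := sub_pos.2 h1
  exact ⟨(h.one_sub h0 h1).mem_E h0' (by linarith), fun hk => h0'.ne' (by exact_mod_cast mem_singleton_iff.1 hk)⟩

theorem stmt12 :
    (E ∩ Set.range ((↑) : ℚ → ℝ)).Infinite ∧
    ∀ x ∈ E ∩ Set.range ((↑) : ℚ → ℝ),
      x ∈ closure ((E ∩ Set.range ((↑) : ℚ → ℝ)) \ {x}) := by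
  constructor
  · intro hfin
    have h := one_mem_closure_E
    rw [(hfin.subset sdiff_subset).isClosed.closure_eq] at h
    exact h.2 rfl
  · rintro x ⟨⟨hI, hx⟩, q, rfl⟩
    rcases hI.1.eq_or_lt with h0 | h0
    · rw [← h0]
      exact zero_mem_closure_E
    rcases hI.2.eq_or_lt with h1 | h1
    · rw [h1]
      exact one_mem_closure_E
    have h0' : 0 < q := by exact_mod_cast h0
    have h1' : q < 1 := by exact_mod_cast h1
    rcases exists_doubleZero_or_matchingGerm h0' h1' with ⟨n, m, h⟩ | h
    · exact h.mem_closure h0' h1'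
    · exact absurd (h.mem_matchingSet h0' h1') hx
end
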